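/- arXiv:2505.09589 — 5 statements merged into one kernel-verified Lean document; each statement's English description precedes it below -/
import Mathlib

section
/- Let d, n ≥ 1 be integers with n ∈ {d, g − d} and n < g, and assume that if n is even then g is odd. Let w : X → ℚ be a weight function such that exactly 2n elements x of X have w(x) = 1/2 and every other value of w has odd denominator. Let G ≤ W be a subgroup containing c and acting transitively on X, and assume that for any two subsets Γ, Γ' ⊆ Fin g with |Γ| = |Γ'| = d there exists σ ∈ G whose induced permutation σ⁺ of Fin g maps Γ onto Γ'. Then there do not exist disjoint subsets T⁺, T⁻ ⊆ Fin g with T⁺ ∪ T⁻ nonempty and |T⁺| + |T⁻| even satisfying the exceptionality identity for ρ = (w, G); in particular ρ is not exceptional. -/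
open scoped BigOperators

namespace PaperAux

/-- The symbol set `X_{2g}`, modeled as `Fin g ⊕ Fin g`. -/
abbrev X (g : ℕ) := Fin g ⊕ Fin g

/-- The complex conjugation involution `c`, swapping `i` and `ī`. -/
def conjPerm (g : ℕ) : Equiv.Perm (X g) := Equiv.sumComm (Fin g) (Fin g)

/-- The group `W_{2g}`: the centralizer of `c` in `Sym(X_{2g})`. -/
def Wgrp (g : ℕ) : Subgroup (Equiv.Perm (X g)) := Subgroup.centralizer {conjPerm g}

/-- `w` is a weight function. -/
structure IsWeightFn (g : ℕ) (w : X g → ℚ) : Prop where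
  nonneg : ∀ x, 0 ≤ w x
  add_one : ∀ i : Fin g, w (Sum.inl i) + w (Sum.inr i) = 1
  mono : ∀ i j : Fin g, i ≤ j → w (Sum.inl i) ≤ w (Sum.inl j)
  den_dvd : ∀ s : ℚ, s.den ∣ (Finset.univ.filter fun x => w x = s).card

/-- The map `Φ_ρ : X → MonoidAlgebra ℚ G`,
`Φ_ρ(x) = ∑_{σ ∈ G} w(σ⁻¹ x) • (σ : MonoidAlgebra ℚ G)`. -/
noncomputable def Phi {g : ℕ} (w : X g → ℚ) (G : Subgroup (Equiv.Perm (X g))) (x : X g) :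
    MonoidAlgebra ℚ G :=
  ∑ᶠ σ : G, w (((σ : Equiv.Perm (X g))⁻¹) x) • MonoidAlgebra.of ℚ G σ

/-- The sum `∑_{σ ∈ G} σ` in the group algebra. -/
noncomputable def allSum {g : ℕ} (G : Subgroup (Equiv.Perm (X g))) : MonoidAlgebra ℚ G :=
  ∑ᶠ σ : G, MonoidAlgebra.of ℚ G σ

/-- `ρ = (w, G)` is geometrically simple (with base point `x₀ = Sum.inl 0`):
the stabilizer of `Φ_ρ(x₀)` under left multiplication equals the stabilizer of `x₀`. -/
def GeomSimple {g : ℕ} (w : X g → ℚ) (G : Subgroup (Equiv.Perm (X g))) (x₀ : X g) : Prop :=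
  ∀ σ : G, MonoidAlgebra.of ℚ G σ * Phi w G x₀ = Phi w G x₀ ↔ (σ : Equiv.Perm (X g)) x₀ = x₀

/-- The exceptionality identity for a pair of disjoint subsets `T⁺, T⁻ ⊆ Fin g`. -/
def ExcId {g : ℕ} (w : X g → ℚ) (G : Subgroup (Equiv.Perm (X g)))
    (Tp Tm : Finset (Fin g)) : Prop :=
  (∑ i ∈ Tp, Phi w G (Sum.inl i)) - (∑ j ∈ Tm, Phi w G (Sum.inl j))
    = (((Tp.card : ℚ) - (Tm.card : ℚ)) / 2) • allSum G

/-- `ρ = (w, G)` is exceptional. -/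
def IsExceptional {g : ℕ} (w : X g → ℚ) (G : Subgroup (Equiv.Perm (X g))) : Prop :=
  ∃ Tp Tm : Finset (Fin g), Disjoint Tp Tm ∧ (Tp ∪ Tm).Nonempty ∧
    Even (Tp.card + Tm.card) ∧ ExcId w G Tp Tm

/-- The induced map `σ⁺ : Fin g → Fin g` of `σ ∈ W`. -/
def plusFun {g : ℕ} (σ : Equiv.Perm (X g)) (i : Fin g) : Fin g :=
  Sum.elim id id (σ (Sum.inl i))

/-- The level set equivalence relation on `Fin g`. -/
def levelRel {g : ℕ} (G : Subgroup (Equiv.Perm (X g))) (i j : Fin g) : Prop :=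
  ∀ γ ∈ G, (∀ k, plusFun γ k = k) →
    ((γ (Sum.inl i) = Sum.inr i) ↔ (γ (Sum.inl j) = Sum.inr j))

/-- The level set partition, as a setoid. -/
def levelSetoid {g : ℕ} (G : Subgroup (Equiv.Perm (X g))) : Setoid (Fin g) where
  r := levelRel G
  iseqv := ⟨fun _ _ _ _ => Iff.rfl,
            fun h γ hγ h2 => (h γ hγ h2).symm,
            fun h1 h2 γ hγ h3 => (h1 γ hγ h3).trans (h2 γ hγ h3)⟩

/-- `m`: the number of classes of the level set partition. -/
noncomputable def numLevels {g : ℕ} (G : Subgroup (Equiv.Perm (X g))) : ℕ :=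
  Nat.card (Quotient (levelSetoid G))

/-- The angle rank `δ_ρ` of a weighted permutation representation. -/
noncomputable def angleRank {g : ℕ} (w : X g → ℚ) (G : Subgroup (Equiv.Perm (X g))) : ℕ :=
  Module.finrank ℚ (Submodule.span ℚ (Set.range (Phi w G))) - 1

end PaperAux

open PaperAux

namespace PaperAux

/-- Sums of rationals with odd denominators reduce modulo `2`. -/
theorem exists_odd_mul_sum_eq_modEq {ι : Type*} (T : Finset ι) (f : ι → ℚ) (k : ι → ℤ)
    (h : ∀ i ∈ T, ∃ a b : ℤ, Odd b ∧ f i * b = a ∧ a ≡ k i [ZMOD 2]) :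
    ∃ a b : ℤ, Odd b ∧ (∑ i ∈ T, f i) * b = a ∧ a ≡ ∑ i ∈ T, k i [ZMOD 2] := by
  classical
  induction T using Finset.induction_on with
  | empty => exact ⟨0, 1, odd_one, by simp, by simp⟩
  | insert i T hi ih =>
    obtain ⟨a, b, hb, hab, ha⟩ := ih fun j hj => h j (Finset.mem_insert_of_mem hj)
    obtain ⟨a', b', hb', hab', ha'⟩ := h i (Finset.mem_insert_self _ _)
    have hb1 : b ≡ 1 [ZMOD 2] := Int.odd_iff.mp hb
    have hb1' : b' ≡ 1 [ZMOD 2] := Int.odd_iff.mp hb'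
    refine ⟨a' * b + a * b', b' * b, hb'.mul hb, ?_, ?_⟩
    · rw [Finset.sum_insert hi]
      push_cast
      rw [← hab, ← hab']
      ring
    · rw [Finset.sum_insert hi]
      simpa using (ha'.mul hb1).add (ha.mul hb1')

theorem map_conjPerm_of_mem_Wgrp {g : ℕ} {σ : Equiv.Perm (X g)} (hσ : σ ∈ Wgrp g) (x : X g) :
    σ (conjPerm g x) = conjPerm g (σ x) := by
  have h := Subgroup.mem_centralizer_iff.mp hσ (conjPerm g) rfl
  exact (congrArg (fun τ : Equiv.Perm (X g) => τ x) h).symm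

theorem eq_inl_or_inr_plusFun {g : ℕ} (σ : Equiv.Perm (X g)) (i : Fin g) :
    σ (Sum.inl i) = Sum.inl (plusFun σ i) ∨ σ (Sum.inl i) = Sum.inr (plusFun σ i) := by
  unfold plusFun
  cases σ (Sum.inl i) <;> simp

theorem plusFun_injective {g : ℕ} {σ : Equiv.Perm (X g)} (hσ : σ ∈ Wgrp g) :
    Function.Injective (plusFun σ) := by
  intro i j hij
  have hconj : ∀ k, σ (Sum.inr k) = conjPerm g (σ (Sum.inl k)) := fun k =>
    map_conjPerm_of_mem_Wgrp hσ (Sum.inl k)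
  have key : σ (Sum.inl i) = σ (Sum.inl j) ∨ σ (Sum.inl i) = σ (Sum.inr j) := by
    rw [hconj j]
    rcases eq_inl_or_inr_plusFun σ i with h | h <;>
      rcases eq_inl_or_inr_plusFun σ j with h' | h' <;> simp [h, h', hij, conjPerm]
  rcases key with h | h <;> simpa using σ.injective h

theorem apply_eq_half_iff {g : ℕ} {w : X g → ℚ} (hw : IsWeightFn g w) (σ : Equiv.Perm (X g))
    (i : Fin g) : w (σ (Sum.inl i)) = 1 / 2 ↔ w (Sum.inl (plusFun σ i)) = 1 / 2 := by
  have h := hw.add_one (plusFun σ i)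
  rcases eq_inl_or_inr_plusFun σ i with h' | h' <;> rw [h']
  constructor <;> intro h'' <;> linarith

theorem card_half_inl {g n : ℕ} {w : X g → ℚ} (hw : IsWeightFn g w)
    (hhalf : (Finset.univ.filter fun x : X g => w x = 1/2).card = 2 * n) :
    (Finset.univ.filter fun i : Fin g => w (Sum.inl i) = 1/2).card = n := by
  have hiff : ∀ i, w (Sum.inr i) = 1/2 ↔ w (Sum.inl i) = 1/2 := fun i => by
    have h := hw.add_one i
    constructor <;> intro h' <;> linarith
  rw [Finset.card_filter, Fintype.sum_sum_type] at hhalf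
  simp only [hiff] at hhalf
  rw [Finset.card_filter]
  omega

theorem ExcId.sum_eq {g : ℕ} {w : X g → ℚ} {G : Subgroup (Equiv.Perm (X g))}
    {Tp Tm : Finset (Fin g)} (h : ExcId w G Tp Tm) {τ : Equiv.Perm (X g)} (hτ : τ ∈ G) :
    ∑ i ∈ Tp, (2 * w (τ (Sum.inl i)) - 1) + ∑ j ∈ Tm, -(2 * w (τ (Sum.inl j)) - 1) = 0 := by
  classical
  have hΦ : ∀ x : X g, (Phi w G x).coeff ⟨τ, hτ⟩⁻¹ = w (τ x) := fun x => by
    rw [Phi, finsum_eq_sum_of_fintype]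
    simp [MonoidAlgebra.coeff_sum, Finsupp.single_apply]
    rfl
  have hall : (allSum G).coeff ⟨τ, hτ⟩⁻¹ = 1 := by
    rw [allSum, finsum_eq_sum_of_fintype]
    simp [MonoidAlgebra.coeff_sum, Finsupp.single_apply]
  have h' := congrArg (fun f => f.coeff ⟨τ, hτ⟩⁻¹) h
  simp only [MonoidAlgebra.coeff_sub, MonoidAlgebra.coeff_sum, MonoidAlgebra.coeff_smul,
    Finsupp.sub_apply, Finsupp.finsetSum_apply, Finsupp.smul_apply, hΦ, hall, smul_eq_mul] at h'
  simp only [Finset.sum_neg_distrib, Finset.sum_sub_distrib, ← Finset.mul_sum,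
    Finset.sum_const, nsmul_eq_mul]
  linarith

theorem two_mul_sub_one_mul_den (s : ℚ) :
    (2 * s - 1) * ((s.den : ℤ) : ℚ) = ((2 * s.num - s.den : ℤ) : ℚ) := by
  have := Rat.mul_den_eq_num s
  push_cast
  linear_combination 2 * this

/-- Along `τ ∈ G`, an exceptional pair meets the slopes different from `1/2` evenly often. -/
theorem ExcId.even_card_filter_ne_half {g : ℕ} {w : X g → ℚ} {G : Subgroup (Equiv.Perm (X g))}
    {Tp Tm : Finset (Fin g)} (hdisj : Disjoint Tp Tm)
    (hden : ∀ x : X g, w x ≠ 1/2 → Odd (w x).den)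
    (h : ExcId w G Tp Tm) {τ : Equiv.Perm (X g)} (hτ : τ ∈ G) :
    Even ((Tp ∪ Tm).filter fun i => ¬ w (τ (Sum.inl i)) = 1/2).card := by
  have hone : ∀ i : Fin g, ∃ a b : ℤ, Odd b ∧ (2 * w (τ (Sum.inl i)) - 1) * b = a ∧
      a ≡ (if ¬ w (τ (Sum.inl i)) = 1/2 then 1 else 0) [ZMOD 2] := fun i => by
    by_cases hi : w (τ (Sum.inl i)) = 1/2
    · exact ⟨0, 1, odd_one, by rw [hi]; norm_num, by rw [if_neg (not_not.mpr hi)]⟩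
    · refine ⟨_, _, (Int.odd_coe_nat _).mpr (hden _ hi), two_mul_sub_one_mul_den _, ?_⟩
      rw [if_pos hi]
      have hodd := hden _ hi
      rw [Nat.odd_iff] at hodd
      unfold Int.ModEq
      omega
  obtain ⟨a, b, hb, hab, ha⟩ := exists_odd_mul_sum_eq_modEq Tp _ _ fun i _ => hone i
  obtain ⟨a', b', hb', hab', ha'⟩ := exists_odd_mul_sum_eq_modEq Tm
    (fun j => -(2 * w (τ (Sum.inl j)) - 1)) (fun j => if ¬ w (τ (Sum.inl j)) = 1/2 then 1 else 0)
    fun j _ => by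
      obtain ⟨a, b, hb, hab, ha⟩ := hone j
      refine ⟨-a, b, hb, by push_cast; rw [← hab]; ring, ?_⟩
      unfold Int.ModEq at *
      omega
  have hsum := h.sum_eq hτ
  have hzero : a * b' + a' * b = 0 := by
    have : ((a * b' + a' * b : ℤ) : ℚ) = 0 := by
      push_cast
      rw [← hab, ← hab']
      linear_combination (b : ℚ) * b' * hsum
    exact_mod_cast this
  have hb1 : b ≡ 1 [ZMOD 2] := Int.odd_iff.mp hb
  have hb1' : b' ≡ 1 [ZMOD 2] := Int.odd_iff.mp hb'
  have hmod := (ha.mul hb1').add (ha'.mul hb1)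
  rw [hzero, mul_one, mul_one, ← Finset.sum_union hdisj, Finset.sum_boole] at hmod
  have hdvd := Int.modEq_zero_iff_dvd.mp hmod.symm
  rw [even_iff_two_dvd]
  exact_mod_cast hdvd

/-- A nonempty set met evenly by all `n`-subsets, `1 ≤ n < |α|`, is everything. -/
theorem eq_univ_of_forall_even_card_inter {α : Type*} [Fintype α] [DecidableEq α] {n : ℕ}
    (hn : 1 ≤ n) (hlt : n < Fintype.card α) {T : Finset α} (hT : T.Nonempty)
    (h : ∀ S : Finset α, S.card = n → Even (T ∩ S).card) : T = Finset.univ := by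
  by_contra hne
  obtain ⟨y, hy⟩ := hT
  obtain ⟨x, hx⟩ : ∃ x, x ∉ T := by
    by_contra! hall
    exact hne (Finset.eq_univ_iff_forall.mpr hall)
  have hxy : x ≠ y := fun e => hx (e ▸ hy)
  have hcard : n - 1 ≤ (({x, y} : Finset α)ᶜ).card := by
    rw [Finset.card_compl, Finset.card_pair hxy]
    omega
  obtain ⟨R, hR, hRn⟩ := Finset.exists_subset_card_eq hcard
  have hxR : x ∉ R := fun hm => by simpa using hR hm
  have hyR : y ∉ R := fun hm => by simpa using hR hm
  have h1 := h (insert x R) (by rw [Finset.card_insert_of_notMem hxR]; omega)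
  have h2 := h (insert y R) (by rw [Finset.card_insert_of_notMem hyR]; omega)
  rw [Finset.inter_insert_of_notMem hx] at h1
  rw [Finset.inter_insert_of_mem hy, Finset.card_insert_of_notMem (by simp [hyR])] at h2
  exact (Nat.even_add_one.mp h2) h1

/-- A `d`-homogeneous group of signed permutations is `n`-homogeneous for `n ∈ {d, g - d}`. -/
theorem exists_mem_iff_plusFun_mem {g d n : ℕ} (hn1 : 1 ≤ n) (hn : n = d ∨ n = g - d)
    {G : Subgroup (Equiv.Perm (X g))} (hGW : G ≤ Wgrp g)
    (hhom : ∀ Γ Γ' : Finset (Fin g), Γ.card = d → Γ'.card = d →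
      ∃ σ ∈ G, Γ.image (plusFun σ) = Γ')
    {S H : Finset (Fin g)} (hS : S.card = n) (hH : H.card = n) :
    ∃ τ ∈ G, ∀ i, plusFun τ i ∈ H ↔ i ∈ S := by
  rcases hn with rfl | rfl
  · obtain ⟨τ, hτ, himg⟩ := hhom S H hS hH
    refine ⟨τ, hτ, fun i => ?_⟩
    rw [← himg, (plusFun_injective (hGW hτ)).mem_finset_image]
  · obtain ⟨τ, hτ, himg⟩ := hhom Sᶜ Hᶜ (by rw [Finset.card_compl, Fintype.card_fin]; omega)
      (by rw [Finset.card_compl, Fintype.card_fin]; omega)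
    refine ⟨τ, hτ, fun i => ?_⟩
    have hi := (plusFun_injective (hGW hτ)).mem_finset_image (s := Sᶜ) (a := i)
    rw [himg, Finset.mem_compl, Finset.mem_compl] at hi
    exact not_iff_not.mp hi

end PaperAux

/-- `d`-homogeneous groups and a slope-`1/2` segment of length `2n`,
`n ∈ {d, g−d}`, with all other slopes of odd denominator, give no exceptional pairs. -/
theorem n_trans_not_exceptional {g d n : ℕ} (hd : 1 ≤ d) (hn1 : 1 ≤ n)
    (hn : n = d ∨ n = g - d) (hnlt : n < g) (hpar : Even n → Odd g)
    (w : X g → ℚ) (hw : IsWeightFn g w)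
    (hhalf : (Finset.univ.filter fun x : X g => w x = 1/2).card = 2 * n)
    (hden : ∀ x : X g, w x ≠ 1/2 → Odd (w x).den)
    (G : Subgroup (Equiv.Perm (X g))) (hGW : G ≤ Wgrp g) (hc : conjPerm g ∈ G)
    (htrans : ∀ x y : X g, ∃ σ ∈ G, σ x = y)
    (hhom : ∀ Γ Γ' : Finset (Fin g), Γ.card = d → Γ'.card = d →
      ∃ σ ∈ G, Γ.image (plusFun σ) = Γ') :
    ¬ ∃ Tp Tm : Finset (Fin g), Disjoint Tp Tm ∧ (Tp ∪ Tm).Nonempty ∧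
        Even (Tp.card + Tm.card) ∧ ExcId w G Tp Tm := by
  rintro ⟨Tp, Tm, hdisj, hne, heven, hexc⟩
  rw [← Finset.card_union_of_disjoint hdisj] at heven
  have hinter : ∀ S : Finset (Fin g), S.card = n → Even ((Tp ∪ Tm) ∩ S).card := fun S hS => by
    obtain ⟨τ, hτ, hmem⟩ := exists_mem_iff_plusFun_mem hn1 hn hGW hhom hS (card_half_inl hw hhalf)
    have hodd := hexc.even_card_filter_ne_half hdisj hden hτ
    have hiff : ∀ i, w (τ (Sum.inl i)) = 1/2 ↔ i ∈ S := fun i => by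
      rw [apply_eq_half_iff hw, ← hmem i]
      simp
    simp only [hiff] at hodd
    rw [← Finset.card_filter_add_card_filter_not (s := Tp ∪ Tm) (· ∈ S), Finset.filter_mem_eq_inter]
      at heven
    exact (Nat.even_add.mp heven).mpr hodd
  have huniv := eq_univ_of_forall_even_card_inter hn1 (by simpa using hnlt) hne hinter
  rw [huniv] at heven hinter
  obtain ⟨S, -, hS⟩ := Finset.exists_subset_card_eq
    (s := (Finset.univ : Finset (Fin g))) (n := n) (by simpa using hnlt.le)
  have hnev : Even n := by simpa [hS] using hinter S hS
  exact Nat.not_even_iff_odd.mpr (hpar hnev) (by simpa using heven)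
end

section
/- Let g be odd and let n ∈ {2, g − 2} with 1 ≤ n < g. Let w : X → ℚ be a weight function such that exactly 2n elements x of X have w(x) = 1/2 and every other value of w has odd denominator. Let G ≤ W be a subgroup containing c, acting transitively on X, and such that the induced action of G on Fin g (via σ ↦ σ⁺) is primitive (preprimitive: every G-invariant partition of Fin g is trivial). Then there do not exist disjoint subsets T⁺, T⁻ ⊆ Fin g with T⁺ ∪ T⁻ nonempty and |T⁺| + |T⁻| even satisfying the exceptionality identity for ρ = (w, G); in particular ρ is not exceptional. -/
open scoped BigOperators

open PaperAux

/-- If each term of a finite sum of rationals is zero or a quotient of odd integers, then some odd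
multiple of the sum is an integer with the parity of the number of nonzero terms. -/
lemma exists_odd_mul_sum_eq {ι : Type*} (S : Finset ι) (f : ι → ℚ)
    (hf : ∀ i ∈ S, f i ≠ 0 → Odd (f i).num ∧ Odd (f i).den) :
    ∃ d m : ℤ, Odd d ∧ (d : ℚ) * ∑ i ∈ S, f i = m ∧
      (Even m ↔ Even (S.filter fun i => f i ≠ 0).card) := by
  classical
  induction S using Finset.induction_on with
  | empty => exact ⟨1, 0, odd_one, by simp, by simp⟩
  | insert a S ha ih =>
    obtain ⟨d, m, hd, hdm, hm⟩ := ih fun i hi => hf i (Finset.mem_insert_of_mem hi)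
    rw [Finset.sum_insert ha, Finset.filter_insert]
    by_cases h0 : f a = 0
    · refine ⟨d, m, hd, by rw [h0, zero_add, hdm], by simpa [h0] using hm⟩
    · obtain ⟨hnum, hden⟩ := hf a (Finset.mem_insert_self a S) h0
      have hden' : Odd ((f a).den : ℤ) := by exact_mod_cast hden
      refine ⟨d * (f a).den, d * (f a).num + m * (f a).den, hd.mul hden', ?_, ?_⟩
      · have h1 : f a * (f a).den = (f a).num := Rat.mul_den_eq_num (f a)
        push_cast
        rw [← h1, ← hdm]
        ring
      · rw [if_pos h0, Finset.card_insert_of_notMem (by simp [ha]), Nat.even_add_one, ← hm,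
          Int.even_add, Int.even_mul, Int.even_mul]
        rw [← Int.not_even_iff_odd] at hd hnum hden'
        tauto

/-- A rational with odd denominator, doubled and decreased by one, is a quotient of odd integers. -/
lemma odd_num_den_two_mul_sub_one {q : ℚ} (hq : Odd q.den) :
    Odd (2 * q - 1).num ∧ Odd (2 * q - 1).den := by
  have h1 : q * q.den = q.num := Rat.mul_den_eq_num q
  have hz : Odd (q.den : ℤ) := by exact_mod_cast hq
  have hne : (q.den : ℤ) ≠ 0 := by exact_mod_cast q.den_ne_zero
  have hodd : Odd (2 * q.num - q.den) := (even_two_mul _).sub_odd hz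
  have heq : 2 * q - 1 = ((2 * q.num - q.den : ℤ) : ℚ) / ((q.den : ℤ) : ℚ) := by
    rw [eq_div_iff (by exact_mod_cast hne)]
    push_cast
    rw [← h1]
    ring
  have hnum := Rat.num_dvd (2 * q.num - q.den) hne
  have hden := Rat.den_dvd (2 * q.num - q.den) q.den
  rw [Rat.divInt_eq_div, ← heq] at hnum hden
  refine ⟨?_, ?_⟩
  · obtain ⟨k, hk⟩ := hnum
    rw [hk, Int.odd_mul] at hodd
    exact hodd.1
  · exact hq.of_dvd_nat (by exact_mod_cast hden)

lemma Phi_apply {g : ℕ} (w : X g → ℚ) (G : Subgroup (Equiv.Perm (X g))) (x : X g) (σ : G) :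
    (Phi w G x).coeff σ = w ((σ : Equiv.Perm (X g))⁻¹ x) := by
  classical
  have := Fintype.ofFinite G
  rw [Phi, finsum_eq_sum_of_fintype]
  simp [MonoidAlgebra.of_apply, MonoidAlgebra.coeff_single, Finsupp.single_apply]

lemma allSum_apply {g : ℕ} (G : Subgroup (Equiv.Perm (X g))) (σ : G) :
    (allSum G).coeff σ = 1 := by
  classical
  have := Fintype.ofFinite G
  rw [allSum, finsum_eq_sum_of_fintype]
  simp [MonoidAlgebra.of_apply, MonoidAlgebra.coeff_single, Finsupp.single_apply]

/-- The exceptionality identity, read off coefficient by coefficient. -/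
lemma PaperAux.ExcId.sum_eq_s13 {g : ℕ} {w : X g → ℚ} {G : Subgroup (Equiv.Perm (X g))}
    {Tp Tm : Finset (Fin g)} (h : ExcId w G Tp Tm) {σ : Equiv.Perm (X g)} (hσ : σ ∈ G) :
    ∑ i ∈ Tp, (2 * w (σ (Sum.inl i)) - 1) - ∑ i ∈ Tm, (2 * w (σ (Sum.inl i)) - 1) = 0 := by
  have h1 := congrArg (fun a => a.coeff (⟨σ, hσ⟩⁻¹ : G)) h
  simp only [MonoidAlgebra.coeff_sub, MonoidAlgebra.coeff_sum, MonoidAlgebra.coeff_smul,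
    Finsupp.sub_apply, Finsupp.finsetSum_apply, Finsupp.smul_apply, Phi_apply, allSum_apply] at h1
  simp only [InvMemClass.coe_inv, inv_inv, smul_eq_mul, mul_one] at h1
  simp only [Finset.sum_sub_distrib, ← Finset.mul_sum, Finset.sum_const, nsmul_eq_mul, mul_one]
  linarith

lemma apply_swap_of_mem_Wgrp {g : ℕ} {σ : Equiv.Perm (X g)} (hσ : σ ∈ Wgrp g) (x : X g) :
    σ x.swap = (σ x).swap := by
  have h := Subgroup.mem_centralizer_iff.1 hσ (conjPerm g) rfl
  exact (DFunLike.congr_fun h x).symm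

lemma plusFun_mul {g : ℕ} {σ τ : Equiv.Perm (X g)} (hσ : σ ∈ Wgrp g) (i : Fin g) :
    plusFun (σ * τ) i = plusFun σ (plusFun τ i) := by
  rcases h : τ (Sum.inl i) with j | j
  · simp [plusFun, h]
  · have h2 := apply_swap_of_mem_Wgrp hσ (Sum.inl j)
    rw [Sum.swap_inl] at h2
    rcases h3 : σ (Sum.inl j) with k | k <;> simp [plusFun, h, h2, h3]

lemma PaperAux.IsWeightFn.eq_half_iff {g : ℕ} {w : X g → ℚ} (hw : IsWeightFn g w)
    (σ : Equiv.Perm (X g)) (i : Fin g) :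
    w (σ (Sum.inl i)) = 1 / 2 ↔ w (Sum.inl (plusFun σ i)) = 1 / 2 := by
  rcases h : σ (Sum.inl i) with j | j
  · simp [plusFun, h]
  · have := hw.add_one j
    simp only [plusFun, h, Sum.elim_inr, id]
    constructor <;> intro h <;> linarith

/-- The number of `i : Fin g` of weight `1/2` is half the number of such elements of `X g`. -/
lemma PaperAux.IsWeightFn.two_mul_card_half {g : ℕ} {w : X g → ℚ} (hw : IsWeightFn g w) :
    (Finset.univ.filter fun x : X g => w x = 1 / 2).card =
      2 * (Finset.univ.filter fun i : Fin g => w (Sum.inl i) = 1 / 2).card := by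
  have h : ∀ i, w (Sum.inr i) = 1 / 2 ↔ w (Sum.inl i) = 1 / 2 := fun i => by
    have := hw.add_one i
    constructor <;> intro h <;> linarith
  simp only [Finset.card_filter, Fintype.sum_sum_type, h]
  ring

/-- The number of elements of `T⁺ ∪ T⁻` that `σ` moves to a slope different from `1/2` is even. -/
lemma PaperAux.ExcId.even_card_ne_half {g : ℕ} {w : X g → ℚ} {G : Subgroup (Equiv.Perm (X g))}
    {Tp Tm : Finset (Fin g)} (hw : IsWeightFn g w) (hden : ∀ x, w x ≠ 1 / 2 → Odd (w x).den)
    (hT : Disjoint Tp Tm) (h : ExcId w G Tp Tm) {σ : Equiv.Perm (X g)} (hσ : σ ∈ G) :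
    Even ((Tp ∪ Tm).filter fun i => w (Sum.inl (plusFun σ i)) ≠ 1 / 2).card := by
  set u : Fin g → ℚ := fun i => 2 * w (σ (Sum.inl i)) - 1 with hu
  set f : Fin g → ℚ := fun i => if i ∈ Tp then u i else -u i with hf
  have hu0 : ∀ i, u i ≠ 0 ↔ w (σ (Sum.inl i)) ≠ 1 / 2 := fun i => by
    refine not_congr ⟨fun h => ?_, fun h => ?_⟩ <;> simp only [hu] at * <;> linarith
  have hf0 : ∀ i, f i ≠ 0 ↔ w (Sum.inl (plusFun σ i)) ≠ 1 / 2 := fun i => by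
    rw [ne_eq (w _), ← hw.eq_half_iff σ i, ← ne_eq (w _), ← hu0]
    by_cases hi : i ∈ Tp <;> simp [hf, hi]
  obtain ⟨d, m, -, hdm, hm⟩ := exists_odd_mul_sum_eq (Tp ∪ Tm) f fun i _ hi => by
    have := odd_num_den_two_mul_sub_one
      (hden _ ((not_congr (hw.eq_half_iff σ i)).2 ((hf0 i).1 hi)))
    simp only [hf]
    split_ifs
    · exact this
    · rwa [Rat.neg_num, Rat.neg_den, odd_neg]
  have hsum : ∑ i ∈ Tp ∪ Tm, f i = 0 := by
    rw [Finset.sum_union hT, ← h.sum_eq_s13 hσ, sub_eq_add_neg, ← Finset.sum_neg_distrib]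
    congr 1
    · exact Finset.sum_congr rfl fun i hi => by simp [hf, hu, hi]
    · exact Finset.sum_congr rfl fun i hi => by
        simp [hf, hu, Finset.disjoint_right.1 hT hi]
  rw [hsum, mul_zero, eq_comm, Int.cast_eq_zero] at hdm
  simp only [hf0] at hm
  exact hm.1 (by simp [hdm])

/-- A set meeting a pair in an even number of elements contains both of its elements or neither. -/
lemma mem_iff_mem_of_even_card {α : Type*} [DecidableEq α] {T : Finset α} {a b : α}
    (h : Even (T.filter fun i => i = a ∨ i = b).card) : a ∈ T ↔ b ∈ T := by
  rw [Finset.filter_or, Finset.filter_eq', Finset.filter_eq'] at h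
  by_cases ha : a ∈ T <;> by_cases hb : b ∈ T <;> simp_all

/-- for odd `g`, `n ∈ {2, g−2}`, a slope-`1/2` segment of length `2n` with
all other slopes of odd denominator, and `G` acting primitively on `Fin g`, there are no
exceptional pairs. -/
theorem primitive_not_exceptional {g n : ℕ} (hgodd : Odd g) (hn : n = 2 ∨ n = g - 2)
    (hn1 : 1 ≤ n) (hnlt : n < g)
    (w : X g → ℚ) (hw : IsWeightFn g w)
    (hhalf : (Finset.univ.filter fun x : X g => w x = 1/2).card = 2 * n)
    (hden : ∀ x : X g, w x ≠ 1/2 → Odd (w x).den)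
    (G : Subgroup (Equiv.Perm (X g))) (hGW : G ≤ Wgrp g) (hc : conjPerm g ∈ G)
    (htrans : ∀ x y : X g, ∃ σ ∈ G, σ x = y)
    (hprim : ∀ r : Fin g → Fin g → Prop, Equivalence r →
      (∀ σ ∈ G, ∀ i j : Fin g, r i j → r (plusFun σ i) (plusFun σ j)) →
      (∀ i j : Fin g, r i j → i = j) ∨ (∀ i j : Fin g, r i j)) :
    ¬ ∃ Tp Tm : Finset (Fin g), Disjoint Tp Tm ∧ (Tp ∪ Tm).Nonempty ∧
        Even (Tp.card + Tm.card) ∧ ExcId w G Tp Tm := by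
  rintro ⟨Tp, Tm, hT, hne, heven, hE⟩
  set T := Tp ∪ Tm with hTdef
  rw [← Finset.card_union_of_disjoint hT, ← hTdef] at heven
  have hcard : (Finset.univ.filter fun i : Fin g => w (Sum.inl i) = 1 / 2).card = n := by
    have := hw.two_mul_card_half
    lia
  have hcard' := Finset.card_filter_add_card_filter_not (s := (Finset.univ : Finset (Fin g)))
    (fun i : Fin g => w (Sum.inl i) = 1 / 2)
  rw [hcard, Finset.card_univ, Fintype.card_fin] at hcard'
  have hne_half : ∀ σ ∈ G, Even (T.filter fun i => w (Sum.inl (plusFun σ i)) ≠ 1 / 2).card :=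
    fun σ hσ => hE.even_card_ne_half hw hden hT hσ
  have hhalf' : ∀ σ ∈ G, Even (T.filter fun i => w (Sum.inl (plusFun σ i)) = 1 / 2).card := by
    intro σ hσ
    have h1 := Finset.card_filter_add_card_filter_not (s := T)
      (fun i => w (Sum.inl (plusFun σ i)) = 1 / 2)
    rw [← h1] at heven
    exact (Nat.even_add.1 heven).2 (hne_half σ hσ)
  obtain ⟨a, b, hab, hpair⟩ : ∃ a b : Fin g, a ≠ b ∧
      ∀ σ ∈ G, Even (T.filter fun i => plusFun σ i = a ∨ plusFun σ i = b).card := by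
    rcases hn with rfl | rfl
    · obtain ⟨a, b, hab, h⟩ := Finset.card_eq_two.1 hcard
      have h' : ∀ i, w (Sum.inl i) = 1 / 2 ↔ i = a ∨ i = b := fun i => by
        simpa using Finset.ext_iff.1 h i
      exact ⟨a, b, hab, by simpa only [h'] using hhalf'⟩
    · obtain ⟨a, b, hab, h⟩ := Finset.card_eq_two.1
        (show (Finset.univ.filter fun i : Fin g => ¬ w (Sum.inl i) = 1 / 2).card = 2 by lia)
      have h' : ∀ i, w (Sum.inl i) ≠ 1 / 2 ↔ i = a ∨ i = b := fun i => by
        simpa using Finset.ext_iff.1 h i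
      exact ⟨a, b, hab, by simpa only [h'] using hne_half⟩
  have hone : ∀ i : Fin g, plusFun (1 : Equiv.Perm (X g)) i = i := fun i => rfl
  have hinv : ∀ σ ∈ G, ∀ i j, plusFun σ i = j ↔ i = plusFun σ⁻¹ j := by
    intro σ hσ i j
    constructor
    · rintro rfl
      rw [← plusFun_mul (hGW (G.inv_mem hσ)), inv_mul_cancel, hone]
    · rintro rfl
      rw [← plusFun_mul (hGW hσ), mul_inv_cancel, hone]
  rcases hprim (fun i j => ∀ σ ∈ G, plusFun σ i ∈ T ↔ plusFun σ j ∈ T)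
    ⟨fun _ _ _ => Iff.rfl, fun h σ hσ => (h σ hσ).symm,
      fun h₁ h₂ σ hσ => (h₁ σ hσ).trans (h₂ σ hσ)⟩
    (fun σ hσ i j h τ hτ => by
      rw [← plusFun_mul (hGW hτ), ← plusFun_mul (hGW hτ)]
      exact h _ (G.mul_mem hτ hσ)) with h | h
  · refine hab (h a b fun σ hσ => mem_iff_mem_of_even_card ?_)
    simpa only [hinv _ (G.inv_mem hσ), inv_inv] using hpair σ⁻¹ (G.inv_mem hσ)
  · obtain ⟨t, ht⟩ := hne
    have huniv : T = Finset.univ := Finset.eq_univ_of_forall fun i =>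
      (h t i 1 G.one_mem).1 ht
    rw [huniv, Finset.card_univ, Fintype.card_fin] at heven
    exact Nat.not_even_iff_odd.2 hgodd heven
end

section
/- Let K ⊆ L be number fields with L/K a Galois extension. Let I be a nonzero ideal of 𝒪_L with σ(I) = I for every σ ∈ Gal(L/K). Let e be a positive integer such that for every maximal ideal 𝔓 of 𝒪_L, the ramification index of 𝔓 over the maximal ideal 𝔓 ∩ 𝒪_K of 𝒪_K divides e times the multiplicity of 𝔓 in the prime factorization of I. Set J = I^e ∩ 𝒪_K (an ideal of 𝒪_K). Then J·𝒪_L = I^e. -/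
open NumberField

open scoped Classical in
/-- The multiplicity of a (maximal) ideal `P` in the unique factorization of a nonzero
ideal `I` of a Dedekind domain. -/
noncomputable def multIdx {R : Type*} [CommRing R] [IsDedekindDomain R]
    (P I : Ideal R) : ℕ :=
  Multiset.count P (UniqueFactorizationMonoid.normalizedFactors I)

open UniqueFactorizationMonoid

section multIdx

variable {S : Type*} [CommRing S] [IsDedekindDomain S] {P A B : Ideal S}

theorem multIdx_mul (hA : A ≠ 0) (hB : B ≠ 0) :
    multIdx P (A * B) = multIdx P A + multIdx P B := by
  simp [multIdx, normalizedFactors_mul hA hB]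

theorem multIdx_pow (A : Ideal S) (n : ℕ) : multIdx P (A ^ n) = n * multIdx P A := by
  simp [multIdx, normalizedFactors_pow]

theorem dvd_iff_forall_multIdx_le (hA : A ≠ 0) (hB : B ≠ 0) :
    A ∣ B ↔ ∀ P : Ideal S, multIdx P A ≤ multIdx P B := by
  classical
  rw [dvd_iff_normalizedFactors_le_normalizedFactors hA hB, Multiset.le_iff_count]
  rfl

theorem multIdx_pos_iff (hA : A ≠ 0) : 0 < multIdx P A ↔ P.IsPrime ∧ A ≤ P := by
  rw [multIdx, Multiset.count_pos, Ideal.mem_normalizedFactors_iff hA]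

end multIdx

section Galois

open scoped Pointwise

variable {R S : Type*} [CommRing R] [CommRing S] [Algebra R S]

theorem Ideal.smul_map_algebraMap {G : Type*} [Group G] [MulSemiringAction G S]
    [SMulCommClass G R S] (g : G) (p : Ideal R) :
    g • p.map (algebraMap R S) = p.map (algebraMap R S) := by
  rw [Ideal.pointwise_smul_def, Ideal.map_map]
  congr 1
  ext r
  simp [smul_algebraMap]

variable [IsDedekindDomain S]

theorem under_eq_of_multIdx_pos {p : Ideal R} [p.IsMaximal] {Q : Ideal S}
    (hp : p.map (algebraMap R S) ≠ 0) (hQ : 0 < multIdx Q (p.map (algebraMap R S))) :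
    Q.under R = p := by
  obtain ⟨hQ, hle⟩ := (multIdx_pos_iff hp).1 hQ
  exact (Ideal.IsMaximal.eq_of_le ‹_› (Ideal.IsPrime.under R Q).ne_top
    (Ideal.map_le_iff_le_comap.1 hle)).symm

variable [Algebra.IsIntegral R S]

/-- If `A` is a Galois-stable ideal all of whose multiplicities are divisible by the corresponding
ramification indices, then the extension of `P ∩ R` divides `A` for every prime `P` dividing `A`. -/
theorem map_under_dvd_of_smul_eq (G : Type*) [Group G] [Finite G] [MulSemiringAction G S]
    [SMulCommClass G R S] [Algebra.IsInvariant R S G] {A P : Ideal S} (hA : A ≠ 0)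
    (hfix : ∀ g : G, g • A = A)
    (hdvd : ∀ Q : Ideal S, Q.IsMaximal →
      multIdx Q ((Q.under R).map (algebraMap R S)) ∣ multIdx Q A)
    (hP : P.IsMaximal) (hPA : A ≤ P) (hP0 : (P.under R).map (algebraMap R S) ≠ 0) :
    (P.under R).map (algebraMap R S) ∣ A := by
  rw [dvd_iff_forall_multIdx_le hP0 hA]
  intro Q
  rcases Nat.eq_zero_or_pos (multIdx Q ((P.under R).map (algebraMap R S))) with h | h
  · simp [h]
  obtain ⟨hQ, hle⟩ := (multIdx_pos_iff hP0).1 h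
  have : (P.under R).IsMaximal := Ideal.isMaximal_comap_of_isIntegral_of_isMaximal P
  have hunder : P.under R = Q.under R := (under_eq_of_multIdx_pos hP0 h).symm
  obtain ⟨g, rfl⟩ := Algebra.IsInvariant.exists_smul_of_under_eq R S G P Q hunder
  have hmax : (g • P).IsMaximal :=
    hQ.isMaximal (ne_bot_of_le_ne_bot hP0 hle)
  have hQA : A ≤ g • P := by
    rw [← hfix g]
    exact Ideal.map_mono hPA
  rw [hunder]
  exact Nat.le_of_dvd ((multIdx_pos_iff hA).2 ⟨hQ, hQA⟩) (hdvd _ hmax)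

theorem exists_map_algebraMap_eq_of_smul_eq [IsDomain R] [FaithfulSMul R S] (G : Type*)
    [Group G] [Finite G] [MulSemiringAction G S] [SMulCommClass G R S]
    [Algebra.IsInvariant R S G] {A : Ideal S} (hA : A ≠ 0) (hfix : ∀ g : G, g • A = A)
    (hdvd : ∀ Q : Ideal S, Q.IsMaximal →
      multIdx Q ((Q.under R).map (algebraMap R S)) ∣ multIdx Q A) :
    ∃ J : Ideal R, J.map (algebraMap R S) = A := by
  induction A using WellFounded.induction (wellFounded_dvdNotUnit (α := Ideal S)) with
  | _ A ih =>
  by_cases htop : A = ⊤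
  · exact ⟨⊤, by rw [htop, Ideal.map_top]⟩
  obtain ⟨P, hP, hPA⟩ := Ideal.exists_le_maximal A htop
  have hP0 : (P.under R).map (algebraMap R S) ≠ 0 := by
    rw [Ideal.zero_eq_bot, Ne,
      Ideal.map_eq_bot_iff_of_injective (FaithfulSMul.algebraMap_injective R S)]
    exact Ideal.IsIntegral.comap_ne_bot R (ne_bot_of_le_ne_bot hA hPA)
  obtain ⟨B, rfl⟩ := map_under_dvd_of_smul_eq G hA hfix hdvd hP hPA hP0
  have hB : B ≠ 0 := right_ne_zero_of_mul hA
  have hlt : DvdNotUnit B ((P.under R).map (algebraMap R S) * B) := by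
    refine ⟨hB, _, fun h ↦ hP.ne_top (top_le_iff.1 ?_), mul_comm _ _⟩
    rw [← Ideal.isUnit_iff.1 h]
    exact Ideal.map_comap_le
  have hfixB (g : G) : g • B = B := by
    have := hfix g
    rw [smul_mul', Ideal.smul_map_algebraMap] at this
    exact mul_left_cancel₀ hP0 this
  have hdvdB (Q : Ideal S) (hQ : Q.IsMaximal) :
      multIdx Q ((Q.under R).map (algebraMap R S)) ∣ multIdx Q B := by
    have hQA := hdvd Q hQ
    rw [multIdx_mul hP0 hB] at hQA
    refine (Nat.dvd_add_right ?_).1 hQA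
    rcases Nat.eq_zero_or_pos (multIdx Q ((P.under R).map (algebraMap R S))) with h | h
    · simp [h]
    have : (P.under R).IsMaximal := Ideal.isMaximal_comap_of_isIntegral_of_isMaximal P
    rw [under_eq_of_multIdx_pos hP0 h]
  obtain ⟨J, hJ⟩ := ih B hlt hB hfixB hdvdB
  exact ⟨P.under R * J, by rw [Ideal.map_mul, hJ]⟩

end Galois

/-- if `I` is a `Gal(L/K)`-stable ideal of `𝒪_L` and `e` is a positive
integer such that every ramification index `e_𝔓` divides `e` times the multiplicity of
`𝔓` in `I`, then `J := I^e ∩ 𝒪_K` satisfies `J·𝒪_L = I^e`. -/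
theorem galois_stable_ideal_descends (K L : Type*) [Field K] [Field L]
    [NumberField K] [NumberField L] [Algebra K L] [IsGalois K L]
    (I : Ideal (𝓞 L)) (hI : I ≠ 0)
    (hfix : ∀ σ : L ≃ₐ[K] L, Ideal.map (galRestrict (𝓞 K) K L (𝓞 L) σ) I = I)
    (e : ℕ) (he : 0 < e)
    (hdvd : ∀ P : Ideal (𝓞 L), P.IsMaximal →
      multIdx P (Ideal.map (algebraMap (𝓞 K) (𝓞 L)) (P.comap (algebraMap (𝓞 K) (𝓞 L)))) ∣
        e * multIdx P I) :
    Ideal.map (algebraMap (𝓞 K) (𝓞 L)) ((I ^ e).comap (algebraMap (𝓞 K) (𝓞 L))) = I ^ e := by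
  open scoped Pointwise in
  have hsmul (σ : L ≃ₐ[K] L) : σ • I = I := by
    conv_rhs => rw [← hfix σ]
    refine congrArg (fun f : 𝓞 L →+* 𝓞 L ↦ I.map f) (RingHom.ext fun x ↦ ?_)
    exact RingOfIntegers.ext (algebraMap_galRestrict_apply (𝓞 K) σ x).symm
  open scoped Pointwise in
  obtain ⟨J, hJ⟩ := exists_map_algebraMap_eq_of_smul_eq (R := 𝓞 K) (L ≃ₐ[K] L) (pow_ne_zero e hI)
    (fun σ ↦ by rw [smul_pow', hsmul]) (fun Q hQ ↦ by rw [multIdx_pow]; exact hdvd Q hQ)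
  rw [← hJ, Ideal.map_comap_map]
end

section
/- Let K be a number field of degree 4 over ℚ which is Galois over ℚ with Galois group isomorphic to ℤ/2 × ℤ/2, totally complex, equipped with an automorphism τ satisfying ι ∘ τ = (complex conjugation) ∘ ι for every ring homomorphism ι : K →+* ℂ. Assume K contains an element ζ with ζ² = −1, or an element ζ with ζ² + ζ + 1 = 0 (i.e. K ⊇ ℚ(i) or K ⊇ ℚ(ζ₃)). Then there exist a prime number p and an element π ∈ 𝒪_K such that π · τ(π) = p and ℚ(π) = K. In particular π is an ordinary p-Weil number generating K. -/
section EulerProduct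

open Filter Topology

variable {M ι : Type*} [CommMonoid M] [IsCancelMul M] (q : ι → M)

/-- Removing finitely many Euler factors from the sum of a completely multiplicative function. -/
theorem tsum_mul_prod_one_sub_eq_tsum_indicator
    (hq : ∀ i j b, i ≠ j → q i ∣ q j * b → q i ∣ b)
    (f : M →* ℂ) (hf : Summable fun a ↦ ‖f a‖) (S : Finset ι) :
    (∑' a, f a) * ∏ i ∈ S, (1 - f (q i)) =
      ∑' a, Set.indicator {a | ∀ i ∈ S, ¬ q i ∣ a} f a := by
  classical
  induction S using Finset.induction_on with
  | empty => simp
  | insert j S hj ih =>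
    rw [Finset.prod_insert hj, mul_left_comm, ih]
    set A : Set M := {a | ∀ i ∈ S, ¬ q i ∣ a}
    have hA : Summable (A.indicator f) := hf.of_norm.indicator A
    have hinj : Function.Injective (q j * ·) := mul_right_injective (q j)
    have hB : ∑' a, (A ∩ {a | q j ∣ a}).indicator f a = f (q j) * ∑' a, A.indicator f a := by
      rw [← tsum_mul_left, ← hinj.tsum_eq (f := (A ∩ {a | q j ∣ a}).indicator f)]
      · refine tsum_congr fun a ↦ ?_
        have : q j * a ∈ A ∩ {a | q j ∣ a} ↔ a ∈ A := by
          simp only [A, Set.mem_inter_iff, Set.mem_ofPred_eq, dvd_mul_right, and_true]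
          refine forall₂_congr fun i hi ↦ not_congr ⟨hq i j a (by rintro rfl; exact hj hi), ?_⟩
          exact fun h ↦ h.mul_left _
        by_cases ha : a ∈ A
        · rw [Set.indicator_of_mem (this.2 ha), Set.indicator_of_mem ha, map_mul]
        · rw [Set.indicator_of_notMem (mt this.1 ha), Set.indicator_of_notMem ha, mul_zero]
      · intro a ha
        obtain ⟨b, rfl⟩ := (Set.mem_of_indicator_ne_zero ha).2
        exact ⟨b, rfl⟩
    rw [sub_mul, one_mul, ← hB, ← hA.tsum_sub (hf.of_norm.indicator _)]
    refine tsum_congr fun a ↦ ?_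
    by_cases h : q j ∣ a <;> simp [A, Set.indicator, h]
    split_ifs <;> simp

theorem tendsto_tsum_mul_prod_one_sub
    (hq : ∀ i j b, i ≠ j → q i ∣ q j * b → q i ∣ b) (hq' : ∀ a : M, a ≠ 1 → ∃ i, q i ∣ a)
    (hq1 : ∀ i, ¬ q i ∣ 1) (f : M →* ℂ) (hf : Summable fun a ↦ ‖f a‖) :
    Tendsto (fun S : Finset ι ↦ (∑' a, f a) * ∏ i ∈ S, (1 - f (q i))) atTop (𝓝 1) := by
  classical
  simp_rw [tsum_mul_prod_one_sub_eq_tsum_indicator q hq f hf]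
  have : (1 : ℂ) = ∑' a, if a = 1 then f a else 0 := by
    rw [tsum_eq_single 1 (by simp +contextual)]; simp
  rw [this]
  refine tendsto_tsum_of_dominated_convergence hf (fun a ↦ ?_)
    (Eventually.of_forall fun S a ↦ norm_indicator_le_norm_self _ _)
  refine tendsto_const_nhds.congr' ?_
  by_cases ha : a = 1
  · filter_upwards with S
    rw [Set.indicator_of_mem (by subst ha; exact fun i _ ↦ hq1 i), if_pos ha]
  · obtain ⟨i, hi⟩ := hq' a ha
    filter_upwards [eventually_ge_atTop {i}] with S hS
    have : a ∉ {a | ∀ i ∈ S, ¬ q i ∣ a} := fun h ↦ h i (hS (Finset.mem_singleton_self i)) hi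
    rw [Set.indicator_of_notMem this, if_neg ha]

theorem tsum_ne_zero_of_forall_exists_dvd
    (hq : ∀ i j b, i ≠ j → q i ∣ q j * b → q i ∣ b) (hq' : ∀ a : M, a ≠ 1 → ∃ i, q i ∣ a)
    (hq1 : ∀ i, ¬ q i ∣ 1) (f : M →* ℂ) (hf : Summable fun a ↦ ‖f a‖) : ∑' a, f a ≠ 0 :=
  fun h ↦ by simpa [h] using tendsto_tsum_mul_prod_one_sub q hq hq' hq1 f hf

theorem abs_log_norm_tsum_sub_tsum_re_le
    (hq : ∀ i j b, i ≠ j → q i ∣ q j * b → q i ∣ b) (hq' : ∀ a : M, a ≠ 1 → ∃ i, q i ∣ a)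
    (hq1 : ∀ i, ¬ q i ∣ 1) (f : M →* ℂ) (hf : Summable fun a ↦ ‖f a‖)
    (hf2 : ∀ i, ‖f (q i)‖ ≤ 1 / 2) (hfq : Summable fun i ↦ ‖f (q i)‖) :
    |Real.log ‖∑' a, f a‖ - ∑' i, (f (q i)).re| ≤ ∑' i, ‖f (q i)‖ ^ 2 := by
  have hlim := tendsto_tsum_mul_prod_one_sub q hq hq' hq1 f hf
  have hL := tsum_ne_zero_of_forall_exists_dvd q hq hq' hq1 f hf
  have hne i : 1 - f (q i) ≠ 0 := by
    intro h
    have := hf2 i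
    rw [← sub_eq_zero.1 h] at this
    norm_num at this
  have hlog : Tendsto (fun S : Finset ι ↦ ∑ i ∈ S, Real.log ‖1 - f (q i)‖) atTop
      (𝓝 (- Real.log ‖∑' a, f a‖)) := by
    have h1 : Tendsto (fun S : Finset ι ↦ Real.log ‖(∑' a, f a) * ∏ i ∈ S, (1 - f (q i))‖) atTop
        (𝓝 0) := by
      have := (Real.continuousAt_log (x := ‖(1 : ℂ)‖) (by simp)).tendsto.comp hlim.norm
      simpa [Function.comp_def] using this
    have h2 := h1.sub_const (Real.log ‖∑' a, f a‖)
    rw [zero_sub] at h2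
    refine h2.congr fun S ↦ ?_
    rw [norm_mul, Real.log_mul (by simpa using hL)
      (by simpa [Finset.prod_eq_zero_iff] using fun i _ ↦ hne i), norm_prod,
      Real.log_prod (fun i _ ↦ by simpa using hne i)]
    ring
  have hre : Summable fun i ↦ (f (q i)).re :=
    .of_norm_bounded hfq fun i ↦ by simpa using Complex.abs_re_le_norm (f (q i))
  have hsq : Summable fun i ↦ ‖f (q i)‖ ^ 2 :=
    .of_nonneg_of_le (fun _ ↦ by positivity)
      (fun i ↦ by nlinarith [hf2 i, norm_nonneg (f (q i))]) hfq
  have h3 := (hlog.add hre.hasSum).abs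
  have h4 : |-Real.log ‖∑' a, f a‖ + ∑' i, (f (q i)).re| ≤ ∑' i, ‖f (q i)‖ ^ 2 := by
    refine le_of_tendsto h3 (Eventually.of_forall fun S ↦ ?_)
    simp only [← Finset.sum_add_distrib]
    refine (Finset.abs_sum_le_sum_abs _ _).trans
      ((Finset.sum_le_sum fun i _ ↦ ?_).trans (hsq.sum_le_tsum S fun _ _ ↦ by positivity))
    have h5 := Complex.norm_log_one_add_sub_self_le (z := - f (q i))
      (by rw [norm_neg]; linarith [hf2 i])
    rw [norm_neg, ← sub_eq_add_neg, sub_neg_eq_add] at h5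
    have h6 := Complex.abs_re_le_norm (Complex.log (1 - f (q i)) + f (q i))
    rw [Complex.add_re, Complex.log_re] at h6
    refine h6.trans (h5.trans ?_)
    have : (1 - ‖f (q i)‖)⁻¹ ≤ 2 := by
      rw [inv_le_comm₀ (by linarith [hf2 i]) (by norm_num)]
      linarith [hf2 i]
    nlinarith [sq_nonneg ‖f (q i)‖]
  rw [← abs_neg]
  convert h4 using 2
  ring

end EulerProduct

section DirichletSeries

open Filter Topology Asymptotics MeasureTheory

theorem exists_LSeries_sub_isBigO_sub_one {a : ℕ → ℂ} {C : ℝ}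
    (hC : ∀ n : ℕ, ‖∑ k ∈ Finset.Icc 1 n, a k‖ ≤ C * (n : ℝ) ^ (1 / 2 : ℝ))
    (ha : ∀ s : ℝ, 1 < s → LSeriesSummable a s) :
    ∃ l : ℂ, (fun s : ℝ ↦ LSeries a s - l) =O[𝓝[>] 1] fun s ↦ s - 1 := by
  set f : ℝ → ℂ := fun t ↦ ∑ k ∈ Finset.Icc 1 ⌊t⌋₊, a k with hf
  have hf0 : ∀ t < 1, f t = 0 := fun t ht ↦ by
    simp [hf, Nat.floor_eq_zero.2 ht]
  have hC0 : 0 ≤ C := by simpa using (norm_nonneg _).trans (hC 1)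
  have hloc : LocallyIntegrableOn f (Set.Ioi 0) := by
    have := locallyIntegrableOn_mul_sum_Icc (c := a) (m := 1) (a := (0 : ℝ)) le_rfl
      (g := fun _ : ℝ ↦ (1 : ℂ)) (continuous_const.locallyIntegrable.locallyIntegrableOn _)
    simpa only [one_mul] using this.mono_set Set.Ioi_subset_Ici_self
  have htop : f =O[atTop] (· ^ (-(-(1 / 2 : ℝ)))) := by
    refine IsBigO.of_bound C ?_
    filter_upwards [eventually_ge_atTop 0] with t ht
    rw [neg_neg, Real.norm_of_nonneg (by positivity)]
    refine (hC _).trans ?_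
    gcongr
    exact Nat.floor_le ht
  have hbot : f =O[𝓝[>] 0] (· ^ (-(-2 : ℝ))) := by
    refine (isBigO_zero _ _).congr' ?_ EventuallyEq.rfl
    filter_upwards [mem_nhdsWithin_of_mem_nhds (Iio_mem_nhds one_pos)] with t ht
    exact (hf0 t ht).symm
  have hd : DifferentiableAt ℂ (fun z ↦ z * mellin f (-z)) 1 := by
    have h : DifferentiableAt ℂ (mellin f) (-1) :=
      mellin_differentiableAt_of_isBigO_rpow hloc htop (by norm_num) hbot (by norm_num)
    exact differentiableAt_id.mul
      (h.comp (1 : ℂ) (g := mellin f) (f := fun z ↦ -z) differentiableAt_id.neg)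
  have hL : ∀ s : ℝ, 1 < s → LSeries a s = s * mellin f (-s) := by
    intro s hs
    rw [LSeries_eq_mul_integral a (r := 1 / 2) (by norm_num) (by simp; linarith) (ha s hs)
      (IsBigO.of_bound C (Eventually.of_forall fun n ↦ by
        rw [Real.norm_of_nonneg (by positivity : 0 ≤ (n : ℝ) ^ (1 / 2 : ℝ))]; exact hC n)), mellin]
    congr 1
    rw [← integral_Ici_eq_integral_Ioi]
    have hcut := setIntegral_eq_of_subset_of_forall_sdiff_eq_zero (μ := volume)
      (s := Set.Ici (1 : ℝ)) (f := fun t : ℝ ↦ (t : ℂ) ^ (-(s : ℂ) - 1) • f t) measurableSet_Ioi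
      (fun t ht ↦ Set.mem_Ioi.2 (lt_of_lt_of_le one_pos ht))
      (fun t ht ↦ by rw [hf0 t (not_le.1 ht.2), smul_zero])
    rw [hcut]
    refine setIntegral_congr_fun measurableSet_Ici fun t ht ↦ ?_
    simp only [smul_eq_mul, hf]
    rw [mul_comm, neg_add']
  refine ⟨1 * mellin f (-1), ((hd.isBigO_sub.comp_tendsto (k := fun s : ℝ ↦ (s : ℂ)) (l' := 𝓝[>] 1) ?_).congr' ?_
    EventuallyEq.rfl).trans ?_⟩
  · exact Complex.continuous_ofReal.continuousAt.tendsto.mono_left nhdsWithin_le_nhds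
  · filter_upwards [self_mem_nhdsWithin] with s hs
    simp [hL s hs]
  · refine IsBigO.of_bound 1 (Eventually.of_forall fun s ↦ ?_)
    simp only [Function.comp_apply, one_mul]
    rw [← Complex.ofReal_one, ← Complex.ofReal_sub, Complex.norm_real]

end DirichletSeries

section OrderTwo

open Filter Topology Asymptotics

theorem exists_neg_eq_self_of_abs_sum_le {Ψ : Type*} [AddCommGroup Ψ] [Fintype Ψ]
    {F : Ψ → ℝ → ℝ} {B₀ B₁ : ℝ}
    (h₀ : ∀ᶠ s in 𝓝[>] 1, |F 0 s + Real.log (s - 1)| ≤ B₀)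
    (h : ∀ ψ ≠ 0, ∃ B, (∀ᶠ s in 𝓝[>] 1, |F ψ s| ≤ B) ∨
      ∀ᶠ s in 𝓝[>] 1, F ψ s ≤ Real.log (s - 1) + B)
    (hneg : ∀ ψ, F (-ψ) = F ψ) (hsum : ∀ᶠ s in 𝓝[>] 1, |∑ ψ, F ψ s| ≤ B₁) :
    ∃ ψ ≠ 0, -ψ = ψ ∧ ∃ B, ∀ᶠ s in 𝓝[>] 1, F 0 s + F ψ s ≤ B := by
  classical
  have hlog : Tendsto (fun s : ℝ ↦ Real.log (s - 1)) (𝓝[>] 1) atBot := by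
    refine Real.tendsto_log_nhdsGT_zero.comp ?_
    refine tendsto_nhdsWithin_iff.2 ⟨?_, ?_⟩
    · have : Tendsto (fun s : ℝ ↦ s - 1) (𝓝 1) (𝓝 (1 - 1)) :=
        (continuous_id.sub continuous_const).tendsto 1
      rw [sub_self] at this
      exact this.mono_left nhdsWithin_le_nhds
    · filter_upwards [self_mem_nhdsWithin] with s hs
      exact Set.mem_Ioi.2 (sub_pos.2 (Set.mem_Ioi.1 hs))
  have hub : ∀ ψ, ∃ B, ψ ≠ 0 → ∀ᶠ s in 𝓝[>] 1, F ψ s ≤ B := by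
    intro ψ
    by_cases hψ : ψ = 0
    · exact ⟨0, fun h ↦ (h hψ).elim⟩
    obtain ⟨B, hB | hB⟩ := h ψ hψ
    · exact ⟨B, fun _ ↦ hB.mono fun s hs ↦ (le_abs_self _).trans hs⟩
    · refine ⟨B, fun _ ↦ ?_⟩
      filter_upwards [hB, hlog.eventually_le_atBot 0] with s hs hs'
      linarith
  choose U hU using hub
  by_cases hV : ∀ ψ ≠ 0, ∃ B, ∀ᶠ s in 𝓝[>] 1, |F ψ s| ≤ B
  · exfalso
    choose! B hB using hV
    have hall : ∀ᶠ s in 𝓝[>] (1 : ℝ), ∀ ψ ∈ Finset.univ.erase (0 : Ψ), |F ψ s| ≤ B ψ :=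
      (Finset.eventually_all _).2 fun ψ hψ ↦ hB ψ (Finset.ne_of_mem_erase hψ)
    obtain ⟨s, hs₀, hs₁, hs₂, hs₃⟩ := (h₀.and <| hsum.and <| hall.and <|
      hlog.eventually_lt_atBot (-(B₀ + B₁ + ∑ ψ ∈ Finset.univ.erase (0 : Ψ), B ψ))).exists
    rw [← Finset.add_sum_erase _ _ (Finset.mem_univ (0 : Ψ))] at hs₁
    have := (Finset.abs_sum_le_sum_abs (F · s) _).trans (Finset.sum_le_sum hs₂)
    rw [abs_le] at *
    linarith
  obtain ⟨ψ, hψ⟩ := not_forall.1 hV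
  rw [Classical.not_imp] at hψ
  obtain ⟨hψ, hψV⟩ := hψ
  obtain ⟨B, hB⟩ := h ψ hψ
  replace hB := hB.resolve_left fun h' ↦ hψV ⟨B, h'⟩
  refine ⟨ψ, hψ, ?_, B₀ + B, ?_⟩
  · by_contra hne
    have hall : ∀ᶠ s in 𝓝[>] (1 : ℝ),
        ∀ χ ∈ ((Finset.univ.erase (0 : Ψ)).erase ψ).erase (-ψ), F χ s ≤ U χ :=
      (Finset.eventually_all _).2 fun χ hχ ↦ hU χ <| by
        simp only [Finset.mem_erase] at hχ; exact hχ.2.2.1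
    obtain ⟨s, hs₀, hs₁, hs₂, hs₃, hs₄⟩ := (h₀.and <| hsum.and <| hall.and <| hB.and <|
      hlog.eventually_lt_atBot
        (-(B₀ + B₁ + 2 * B + ∑ χ ∈ ((Finset.univ.erase (0 : Ψ)).erase ψ).erase (-ψ), U χ))).exists
    rw [← Finset.add_sum_erase _ _ (Finset.mem_univ (0 : Ψ)),
      ← Finset.add_sum_erase _ _ (Finset.mem_erase.2 ⟨hψ, Finset.mem_univ ψ⟩),
      ← Finset.add_sum_erase _ _ (Finset.mem_erase.2
        ⟨hne, Finset.mem_erase.2 ⟨neg_ne_zero.2 hψ, Finset.mem_univ _⟩⟩), hneg ψ] at hs₁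
    have := Finset.sum_le_sum hs₂
    rw [abs_le] at *
    linarith
  · filter_upwards [h₀, hB] with s hs hs'
    rw [abs_le] at hs
    linarith

end OrderTwo

section TwistedSum

open Filter Topology Asymptotics

variable {M G : Type*} [CommMonoid M] [CommGroup G]

/-- The completely multiplicative function `a ↦ ψ (cl a) * N a ^ (-s)`. -/
noncomputable def twistedPower (N : M →* ℕ) (cl : M →* G) (ψ : AddChar (Additive G) ℂ) (s : ℝ) :
    M →* ℂ where
  toFun a := ψ (.ofMul (cl a)) * (((N a : ℝ) ^ (-s) : ℝ) : ℂ)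
  map_one' := by simp
  map_mul' a b := by
    rw [map_mul N, map_mul cl, ofMul_mul, AddChar.map_add_eq_mul, Nat.cast_mul,
      Real.mul_rpow (by positivity) (by positivity)]
    push_cast
    ring

variable {N : M →* ℕ} {cl : M →* G}

theorem twistedPower_apply (ψ : AddChar (Additive G) ℂ) (s : ℝ) (a : M) :
    twistedPower N cl ψ s a = ψ (.ofMul (cl a)) * (((N a : ℝ) ^ (-s) : ℝ) : ℂ) := rfl

theorem norm_twistedPower [Finite G] (ψ : AddChar (Additive G) ℂ) (s : ℝ) (a : M) :
    ‖twistedPower N cl ψ s a‖ = (N a : ℝ) ^ (-s) := by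
  rw [twistedPower_apply, norm_mul, AddChar.norm_apply, one_mul, Complex.norm_real,
    Real.norm_of_nonneg (by positivity)]

theorem norm_tsum_twistedPower_neg [Finite G] (ψ : AddChar (Additive G) ℂ) (s : ℝ) :
    ‖∑' a, twistedPower N cl (-ψ) s a‖ = ‖∑' a, twistedPower N cl ψ s a‖ := by
  rw [← Complex.norm_conj (∑' a, twistedPower N cl ψ s a), Complex.conj_tsum]
  congr 2
  ext a
  rw [twistedPower_apply, twistedPower_apply, map_mul, Complex.conj_ofReal, AddChar.neg_apply,
    AddChar.map_neg_eq_conj]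

variable {T : ℕ → Finset M} {κ C : ℝ}

/-- The coefficient of `n ^ (-s)` in `∑' a, ψ (cl a) * N a ^ (-s)`. -/
noncomputable def twistedCoeff (N : M →* ℕ) (cl : M →* G) (T : ℕ → Finset M)
    (ψ : AddChar (Additive G) ℂ) (n : ℕ) : ℂ :=
  ∑ a ∈ T n with N a = n, ψ (.ofMul (cl a))

theorem sum_twistedCoeff (hT : ∀ n a, a ∈ T n ↔ N a ≤ n) (hN : ∀ a, N a ≠ 0)
    (ψ : AddChar (Additive G) ℂ) (n : ℕ) :
    ∑ k ∈ Finset.Icc 1 n, twistedCoeff N cl T ψ k = ∑ a ∈ T n, ψ (.ofMul (cl a)) := by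
  rw [← Finset.sum_fiberwise_of_maps_to (s := T n) (t := Finset.Icc 1 n) (g := N)]
  · refine Finset.sum_congr rfl fun k hk ↦ ?_
    refine Finset.sum_congr ?_ fun _ _ ↦ rfl
    ext a
    simp only [Finset.mem_filter, hT, Finset.mem_Icc] at hk ⊢
    omega
  · intro a ha
    have := hN a
    rw [hT] at ha
    rw [Finset.mem_Icc]
    omega

theorem norm_sum_sub_sum_le [Fintype G] [DecidableEq G]
    (h : ∀ g n, |(((T n).filter (cl · = g)).card : ℝ) - κ * n| ≤ C * (n : ℝ) ^ (1 / 2 : ℝ))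
    (ψ : AddChar (Additive G) ℂ) (n : ℕ) :
    ‖∑ a ∈ T n, ψ (.ofMul (cl a)) - κ * n * ∑ g : G, ψ (.ofMul g)‖ ≤
      Fintype.card G * C * (n : ℝ) ^ (1 / 2 : ℝ) := by
  rw [← Finset.sum_fiberwise (T n) cl, Finset.mul_sum, ← Finset.sum_sub_distrib]
  refine (norm_sum_le _ _).trans ?_
  rw [mul_assoc, ← Finset.card_univ, ← nsmul_eq_mul]
  refine Finset.sum_le_card_nsmul _ _ _ fun g _ ↦ ?_
  rw [Finset.sum_congr rfl (g := fun _ ↦ ψ (.ofMul g))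
    fun a ha ↦ by rw [(Finset.mem_filter.1 ha).2], Finset.sum_const, nsmul_eq_mul, ← sub_mul,
    norm_mul, AddChar.norm_apply, mul_one]
  refine (h g n).trans' (le_of_eq ?_)
  rw [← Real.norm_eq_abs, ← Complex.norm_real]
  push_cast
  rfl

theorem summable_natCast_rpow_neg [Fintype G] [DecidableEq G]
    (hT : ∀ n a, a ∈ T n ↔ N a ≤ n) (hN : ∀ a, N a ≠ 0)
    (h : ∀ g n, |(((T n).filter (cl · = g)).card : ℝ) - κ * n| ≤ C * (n : ℝ) ^ (1 / 2 : ℝ))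
    {s : ℝ} (hs : 1 < s) : Summable fun a ↦ (N a : ℝ) ^ (-s) := by
  have hO : (fun n : ℕ ↦ ∑ k ∈ Finset.Icc 1 n, (((T k).filter (N · = k)).card : ℝ)) =O[atTop]
      fun n ↦ (n : ℝ) ^ (1 : ℝ) := by
    have hC : 0 ≤ C := by
      have := h 1 1
      rw [Nat.cast_one, Real.one_rpow, mul_one C] at this
      exact (abs_nonneg _).trans this
    refine IsBigO.of_bound (Fintype.card G * (|κ| + C)) ?_
    filter_upwards [eventually_ge_atTop 1] with n hn
    have hn' : (n : ℝ) ^ (1 / 2 : ℝ) ≤ n := by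
      conv_rhs => rw [← Real.rpow_one (n : ℝ)]
      exact Real.rpow_le_rpow_of_exponent_le (by exact_mod_cast hn) (by norm_num)
    have h1 := norm_sum_sub_sum_le h 0 n
    rw [← sum_twistedCoeff hT hN] at h1
    have h2 : (∑ k ∈ Finset.Icc 1 n, twistedCoeff N cl T 0 k : ℂ) =
        ((∑ k ∈ Finset.Icc 1 n, (((T k).filter (N · = k)).card : ℝ) : ℝ) : ℂ) := by
      simp [twistedCoeff]
    have h3 : κ * n * ∑ g : G, (0 : AddChar (Additive G) ℂ) (.ofMul g) =
        ((κ * n * Fintype.card G : ℝ) : ℂ) := by simp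
    rw [h2, h3, ← Complex.ofReal_sub, Complex.norm_real, Real.norm_eq_abs] at h1
    rw [Real.rpow_one, Real.norm_eq_abs, Real.norm_of_nonneg (Nat.cast_nonneg n)]
    have h4 := abs_sub_abs_le_abs_sub
      (∑ k ∈ Finset.Icc 1 n, (((T k).filter (N · = k)).card : ℝ)) (κ * n * Fintype.card G)
    rw [abs_mul, abs_mul, Nat.abs_cast, Nat.abs_cast] at h4
    have h5 : Fintype.card G * C * (n : ℝ) ^ (1 / 2 : ℝ) ≤ Fintype.card G * C * n := by gcongr
    linarith
  have hL := LSeriesSummable_of_sum_norm_bigO_and_nonneg hO (fun _ ↦ by positivity) zero_le_one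
    (s := (s : ℂ)) (by simpa using hs)
  rw [← (Equiv.sigmaFiberEquiv N).summable_iff, summable_sigma_of_nonneg (fun _ ↦ by
    simp only [Function.comp_apply]; positivity)]
  have hfin (n : ℕ) : Finite {a // N a = n} :=
    ((T n).finite_toSet.subset fun a (ha : N a = n) ↦ (hT n a).2 ha.le).to_subtype
  refine ⟨fun n ↦ Summable.of_finite, ?_⟩
  refine hL.norm.congr fun n ↦ ?_
  rcases eq_or_ne n 0 with rfl | hn
  · have : IsEmpty {a // N a = 0} := ⟨fun a ↦ hN _ a.2⟩
    simp
  · have := Fintype.ofFinite {a // N a = n}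
    rw [LSeries.norm_term_eq, if_neg hn, tsum_fintype]
    have h6 : ∀ c : {a // N a = n}, (fun a ↦ (N a : ℝ) ^ (-s)) (Equiv.sigmaFiberEquiv N ⟨n, c⟩) =
        (n : ℝ) ^ (-s) := fun c ↦ by simp [c.2]
    simp only [Function.comp_apply] at h6 ⊢
    rw [Finset.sum_congr rfl fun c _ ↦ h6 c, Finset.sum_const, nsmul_eq_mul, Finset.card_univ,
      Fintype.card_of_subtype ((T n).filter (N · = n)) (by simp +contextual [hT]),
      Real.rpow_neg (by positivity), div_eq_mul_inv]
    simp

theorem LSeriesHasSum_twistedCoeff [Fintype G] [DecidableEq G]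
    (hT : ∀ n a, a ∈ T n ↔ N a ≤ n) (hN : ∀ a, N a ≠ 0)
    (h : ∀ g n, |(((T n).filter (cl · = g)).card : ℝ) - κ * n| ≤ C * (n : ℝ) ^ (1 / 2 : ℝ))
    (ψ : AddChar (Additive G) ℂ) {s : ℝ} (hs : 1 < s) :
    LSeriesHasSum (twistedCoeff N cl T ψ) s (∑' a, twistedPower N cl ψ s a) := by
  have hsum : Summable fun a ↦ twistedPower N cl ψ s a := by
    refine Summable.of_norm ?_
    simpa only [norm_twistedPower] using summable_natCast_rpow_neg hT hN h hs
  have hterm : LSeries.term (twistedCoeff N cl T ψ) s =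
      fun n ↦ ∑' a : N ⁻¹' {n}, twistedPower N cl ψ s a := funext fun n ↦ ?_
  · rw [LSeriesHasSum, hterm]
    exact hsum.hasSum.tsum_fiberwise N
  symm
  have h1 : N ⁻¹' {n} = (((T n).filter (N · = n) : Finset M) : Set M) := by
    ext a
    simp +contextual [hT]
  rw [h1, Finset.tsum_subtype']
  rcases eq_or_ne n 0 with rfl | hn
  · simp [hN]
  · rw [LSeries.term_of_ne_zero hn, twistedCoeff, Finset.sum_div]
    refine Finset.sum_congr rfl fun a ha ↦ ?_
    rw [twistedPower_apply, (Finset.mem_filter.1 ha).2, Complex.ofReal_cpow (by positivity),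
      Complex.ofReal_neg, Complex.cpow_neg, div_eq_mul_inv, Complex.ofReal_natCast]

theorem exists_abs_log_norm_tsum_twistedPower_zero_le [Fintype G] [DecidableEq G]
    (hT : ∀ n a, a ∈ T n ↔ N a ≤ n) (hN : ∀ a, N a ≠ 0) (hκ : 0 < κ)
    (h : ∀ g n, |(((T n).filter (cl · = g)).card : ℝ) - κ * n| ≤ C * (n : ℝ) ^ (1 / 2 : ℝ)) :
    ∃ B, ∀ᶠ s in 𝓝[>] 1,
      |Real.log ‖∑' a, twistedPower N cl 0 s a‖ + Real.log (s - 1)| ≤ B := by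
  have hlim : Tendsto (fun s : ℝ ↦ (s - 1) * LSeries (twistedCoeff N cl T 0) s) (𝓝[>] 1)
      (𝓝 ((κ * Fintype.card G : ℝ) : ℂ)) := by
    refine LSeries_tendsto_sub_mul_nhds_one_of_tendsto_sum_div ?_
      fun s hs ↦ (LSeriesHasSum_twistedCoeff hT hN h 0 hs).LSeriesSummable
    rw [tendsto_iff_norm_sub_tendsto_zero]
    have h0 : Tendsto (fun n : ℕ ↦ Fintype.card G * C * (n : ℝ) ^ (-(1 / 2 : ℝ))) atTop
        (𝓝 (Fintype.card G * C * 0)) :=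
      ((tendsto_rpow_neg_atTop (by norm_num)).comp tendsto_natCast_atTop_atTop).const_mul _
    rw [mul_zero] at h0
    refine squeeze_zero' (Eventually.of_forall fun _ ↦ norm_nonneg _) ?_ h0
    filter_upwards [eventually_gt_atTop 0] with n hn
    have hn' : (0 : ℝ) < n := by exact_mod_cast hn
    have h1 := norm_sum_sub_sum_le h 0 n
    rw [← sum_twistedCoeff hT hN] at h1
    have h2 : (∑ k ∈ Finset.Icc 1 n, twistedCoeff N cl T 0 k) / (n : ℂ) -
        ((κ * Fintype.card G : ℝ) : ℂ) = (∑ k ∈ Finset.Icc 1 n, twistedCoeff N cl T 0 k -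
          κ * n * ∑ g : G, (0 : AddChar (Additive G) ℂ) (.ofMul g)) / n := by
      have : (n : ℂ) ≠ 0 := by exact_mod_cast hn.ne'
      simp only [AddChar.zero_apply, Finset.sum_const, Finset.card_univ, nsmul_eq_mul, mul_one]
      push_cast
      field_simp
    rw [h2, norm_div, Complex.norm_natCast, div_le_iff₀ hn',
      mul_assoc (Fintype.card G * C : ℝ), ← Real.rpow_add_one hn'.ne']
    norm_num at h1 ⊢
    exact h1
  have hne : ((κ * Fintype.card G : ℝ) : ℂ) ≠ 0 := by
    have := Fintype.card_pos (α := G)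
    exact_mod_cast (by positivity : (0 : ℝ) < κ * Fintype.card G).ne'
  have hlog := ((Real.continuousAt_log (norm_ne_zero_iff.2 hne)).tendsto.comp hlim.norm).abs
  refine ⟨|Real.log ‖((κ * Fintype.card G : ℝ) : ℂ)‖| + 1, ?_⟩
  filter_upwards [hlog.eventually_le_const (lt_add_one _), hlim.eventually_ne hne,
    self_mem_nhdsWithin] with s hs hs0 (hs1 : 1 < s)
  rw [(LSeriesHasSum_twistedCoeff hT hN h 0 hs1).LSeries_eq] at hs0
  rw [Function.comp_apply, (LSeriesHasSum_twistedCoeff hT hN h 0 hs1).LSeries_eq, norm_mul,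
    ← Complex.ofReal_one, ← Complex.ofReal_sub, Complex.norm_real,
    Real.norm_of_nonneg (by linarith), Real.log_mul (by linarith)
      (norm_ne_zero_iff.2 (right_ne_zero_of_mul hs0)), add_comm] at hs
  exact hs

theorem log_norm_bound_of_isBigO {L : ℝ → ℂ} {l : ℂ} (hL : ∀ s, 1 < s → L s ≠ 0)
    (hl : (fun s : ℝ ↦ L s - l) =O[𝓝[>] 1] fun s ↦ s - 1) :
    ∃ B, (∀ᶠ s in 𝓝[>] 1, |Real.log ‖L s‖| ≤ B) ∨
      ∀ᶠ s in 𝓝[>] 1, Real.log ‖L s‖ ≤ Real.log (s - 1) + B := by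
  rcases eq_or_ne l 0 with rfl | hl0
  · obtain ⟨c, hc, hcL⟩ := hl.exists_pos
    refine ⟨Real.log c, .inr ?_⟩
    filter_upwards [hcL.bound, self_mem_nhdsWithin] with s hs (hs1 : 1 < s)
    rw [sub_zero, Real.norm_of_nonneg (by linarith)] at hs
    rw [add_comm, ← Real.log_mul hc.ne' (by linarith)]
    exact Real.log_le_log (norm_pos_iff.2 (hL s hs1)) hs
  · have h0 : Tendsto (fun s : ℝ ↦ s - 1) (𝓝[>] 1) (𝓝 0) := by
      have : Tendsto (fun s : ℝ ↦ s - 1) (𝓝 1) (𝓝 (1 - 1)) :=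
        (continuous_id.sub continuous_const).tendsto 1
      rw [sub_self] at this
      exact this.mono_left nhdsWithin_le_nhds
    have hlim : Tendsto L (𝓝[>] 1) (𝓝 l) := by
      simpa using (hl.trans_tendsto h0).add_const l
    have hlog := ((Real.continuousAt_log (norm_ne_zero_iff.2 hl0)).tendsto.comp hlim.norm).abs
    exact ⟨_, .inl (hlog.eventually_le_const (lt_add_one _))⟩


theorem not_summable_indicator_map_eq_one {ι : Type*} [IsCancelMul M] [Fintype G] [DecidableEq G]
    (q : ι → M) (hq : ∀ i j b, i ≠ j → q i ∣ q j * b → q i ∣ b)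
    (hq' : ∀ a : M, a ≠ 1 → ∃ i, q i ∣ a) (hq1 : ∀ i, ¬ q i ∣ 1) (hq2 : ∀ i, 2 ≤ N (q i))
    (hT : ∀ n a, a ∈ T n ↔ N a ≤ n) (hN : ∀ a, N a ≠ 0) (hκ : 0 < κ)
    (h : ∀ g n, |(((T n).filter (cl · = g)).card : ℝ) - κ * n| ≤ C * (n : ℝ) ^ (1 / 2 : ℝ))
    (hsq : ¬ Summable ({i | IsSquare (cl (q i))}.indicator fun i ↦ (N (q i) : ℝ)⁻¹)) :
    ¬ Summable ({i | cl (q i) = 1}.indicator fun i ↦ (N (q i) : ℝ)⁻¹) := by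
  intro hP
  have hinj : Function.Injective q := fun i j hij ↦ by
    by_contra hne
    exact hq1 i (hq i j 1 hne (by rw [hij, mul_one]))
  set w : ℝ → ι → ℝ := fun s i ↦ (N (q i) : ℝ) ^ (-s) with hw
  have hw0 : ∀ s i, 0 ≤ w s i := fun s i ↦ by positivity
  have hN1 : ∀ i, (1 : ℝ) ≤ N (q i) := fun i ↦ by 
    exact_mod_cast one_le_two.trans (hq2 i)
  have hws : ∀ s, 1 < s → Summable (w s) := fun s hs ↦
    (summable_natCast_rpow_neg hT hN h hs).comp_injective hinj
  have hw1 : ∀ s, 1 < s → ∀ i, w s i ≤ (N (q i) : ℝ)⁻¹ := fun s hs i ↦ by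
    rw [← Real.rpow_neg_one]
    exact Real.rpow_le_rpow_of_exponent_le (hN1 i) (by linarith)
  have hf : ∀ (ψ : AddChar (Additive G) ℂ) s, 1 < s →
      Summable fun a ↦ ‖twistedPower N cl ψ s a‖ := fun ψ s hs ↦ by
    simpa only [norm_twistedPower] using summable_natCast_rpow_neg hT hN h hs
  set D := ∑' i, w 2 i with hD
  have hE : ∀ (ψ : AddChar (Additive G) ℂ) s, 1 < s → |Real.log ‖∑' a, twistedPower N cl ψ s a‖ -
      ∑' i, (ψ (.ofMul (cl (q i)))).re * w s i| ≤ D := by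
    intro ψ s hs
    have h1 := abs_log_norm_tsum_sub_tsum_re_le q hq hq' hq1 (twistedPower N cl ψ s) (hf ψ s hs)
      (fun i ↦ by
        rw [norm_twistedPower]
        refine (hw1 s hs i).trans ?_
        rw [one_div]
        gcongr
        exact_mod_cast hq2 i) ((hf ψ s hs).comp_injective hinj)
    simp only [norm_twistedPower] at h1
    simp only [twistedPower_apply, Complex.re_mul_ofReal] at h1
    refine h1.trans (Summable.tsum_le_tsum (fun i ↦ ?_) ?_ (hws 2 one_lt_two))
    · calc _ ≤ ((N (q i) : ℝ)⁻¹) ^ 2 := by gcongr; exact hw1 s hs i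
        _ = w 2 i := by simp [hw, Real.rpow_neg]
    · refine .of_nonneg_of_le (fun _ ↦ by positivity) (fun i ↦ ?_) (hws s hs)
      change w s i ^ 2 ≤ w s i
      have : w s i ≤ 1 := Real.rpow_le_one_of_one_le_of_nonpos (hN1 i) (by linarith)
      nlinarith [hw0 s i]
  have hre : ∀ (ψ : AddChar (Additive G) ℂ) x, |(ψ x).re| ≤ 1 := fun ψ x ↦
    (Complex.abs_re_le_norm _).trans (AddChar.norm_apply ψ x).le
  have hsum : ∀ (ψ : AddChar (Additive G) ℂ) s, 1 < s →
      Summable fun i ↦ (ψ (.ofMul (cl (q i)))).re * w s i := fun ψ s hs ↦ by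
    refine .of_norm_bounded (hws s hs) fun i ↦ ?_
    rw [norm_mul, Real.norm_of_nonneg (hw0 s i)]
    exact mul_le_of_le_one_left (hw0 s i) (hre ψ _)
  obtain ⟨B₀, hB₀⟩ := exists_abs_log_norm_tsum_twistedPower_zero_le hT hN hκ h
  obtain ⟨ψ, -, hψ, B, hB⟩ := exists_neg_eq_self_of_abs_sum_le
    (F := fun (ψ : AddChar (Additive G) ℂ) s ↦ Real.log ‖∑' a, twistedPower N cl ψ s a‖)
    (B₁ := Fintype.card (AddChar (Additive G) ℂ) * D + Fintype.card G *
      ∑' i, {i | cl (q i) = 1}.indicator (fun i ↦ (N (q i) : ℝ)⁻¹) i) hB₀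
    (fun ψ hψ ↦ by
      obtain ⟨l, hl⟩ := exists_LSeries_sub_isBigO_sub_one (a := twistedCoeff N cl T ψ)
        (C := Fintype.card G * C) (fun n ↦ by
          have h1 := norm_sum_sub_sum_le h ψ n
          have h2 : ∑ g : G, ψ (.ofMul g) = 0 :=
            (Additive.ofMul.sum_comp ψ).trans (AddChar.sum_eq_zero_iff_ne_zero.2 hψ)
          rwa [h2, mul_zero, sub_zero, ← sum_twistedCoeff hT hN] at h1)
        (fun s hs ↦ (LSeriesHasSum_twistedCoeff hT hN h ψ hs).LSeriesSummable)
      refine log_norm_bound_of_isBigO (l := l) (fun s hs ↦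
        tsum_ne_zero_of_forall_exists_dvd q hq hq' hq1 _ (hf ψ s hs)) (hl.congr' ?_ .rfl)
      filter_upwards [self_mem_nhdsWithin] with s (hs : 1 < s)
      rw [(LSeriesHasSum_twistedCoeff hT hN h ψ hs).LSeries_eq])
    (fun ψ ↦ by simp only [norm_tsum_twistedPower_neg])
    (by
      filter_upwards [self_mem_nhdsWithin] with s (hs : 1 < s)
      have h1 : ∑ ψ : AddChar (Additive G) ℂ, ∑' i, (ψ (.ofMul (cl (q i)))).re * w s i =
          Fintype.card G * ∑' i, {i | cl (q i) = 1}.indicator (w s) i := by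
        rw [← Summable.tsum_finsetSum fun ψ _ ↦ hsum ψ s hs, ← tsum_mul_left]
        refine tsum_congr fun i ↦ ?_
        rw [← Finset.sum_mul, ← Complex.re_sum, AddChar.sum_apply_eq_ite]
        by_cases hi : cl (q i) = 1 <;> simp [hi, Set.indicator]
      have h2 : ∑' i, {i | cl (q i) = 1}.indicator (w s) i ≤
          ∑' i, {i | cl (q i) = 1}.indicator (fun i ↦ (N (q i) : ℝ)⁻¹) i :=
        Summable.tsum_le_tsum (fun i ↦ Set.indicator_le_indicator (hw1 s hs i))
          ((hws s hs).indicator _) hP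
      have h3 : 0 ≤ ∑' i, {i | cl (q i) = 1}.indicator (w s) i :=
        tsum_nonneg fun i ↦ Set.indicator_nonneg (fun i _ ↦ hw0 s i) i
      have h4 := Finset.abs_sum_le_sum_abs (fun ψ : AddChar (Additive G) ℂ ↦
        Real.log ‖∑' a, twistedPower N cl ψ s a‖ - ∑' i, (ψ (.ofMul (cl (q i)))).re * w s i)
        Finset.univ
      have h5 := Finset.sum_le_card_nsmul Finset.univ _ D
        fun (ψ : AddChar (Additive G) ℂ) _ ↦ hE ψ s hs
      rw [Finset.sum_sub_distrib, h1] at h4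
      rw [nsmul_eq_mul, Finset.card_univ] at h5
      have h6 := mul_le_mul_of_nonneg_left h2 (Nat.cast_nonneg (α := ℝ) (Fintype.card G))
      have h7 := mul_nonneg (Nat.cast_nonneg (α := ℝ) (Fintype.card G)) h3
      have h8 := h4.trans h5
      rw [abs_le] at h8 ⊢
      constructor <;> linarith)
  refine hsq (summable_of_sum_le (c := B + 2 * D)
    (fun i ↦ Set.indicator_nonneg (fun i _ ↦ by positivity) i) fun S ↦ ?_)
  have hlim : Tendsto (fun s ↦ ∑ i ∈ S, {i | IsSquare (cl (q i))}.indicator (w s) i) (𝓝[>] 1)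
      (𝓝 (∑ i ∈ S, {i | IsSquare (cl (q i))}.indicator (fun i ↦ (N (q i) : ℝ)⁻¹) i)) := by
    refine tendsto_finsetSum _ fun i _ ↦ ?_
    by_cases hi : IsSquare (cl (q i))
    · have h0 : (N (q i) : ℝ) ≠ 0 := by linarith [hN1 i]
      have : Tendsto (fun s : ℝ ↦ (N (q i) : ℝ) ^ (-s)) (𝓝 1) (𝓝 ((N (q i) : ℝ) ^ (-1 : ℝ))) :=
        ((Real.continuousAt_const_rpow h0).comp continuousAt_neg).tendsto
      rw [Real.rpow_neg_one] at this
      simpa [Set.indicator, hi, hw] using this.mono_left nhdsWithin_le_nhds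
    · simp [Set.indicator, hi]
  refine le_of_tendsto hlim ?_
  filter_upwards [hB, self_mem_nhdsWithin] with s hs (hs1 : 1 < s)
  have h0 := hE 0 s hs1
  have h1 := hE ψ s hs1
  have h2 : ∑ i ∈ S, {i | IsSquare (cl (q i))}.indicator (w s) i ≤
      ∑' i, (((0 : AddChar (Additive G) ℂ) (.ofMul (cl (q i)))).re * w s i +
        (ψ (.ofMul (cl (q i)))).re * w s i) := by
    refine (Finset.sum_le_sum fun i _ ↦ ?_).trans (((hsum 0 s hs1).add (hsum ψ s hs1)).sum_le_tsum S
      fun i _ ↦ ?_)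
    · rw [AddChar.zero_apply, Complex.one_re, ← add_mul]
      by_cases hi : IsSquare (cl (q i))
      · have h3 : ψ (.ofMul (cl (q i))) = 1 := by
          obtain ⟨x, hx⟩ := hi
          rw [hx, ofMul_mul, AddChar.map_add_eq_mul]
          nth_rewrite 1 [← hψ]
          rw [AddChar.neg_apply, ← AddChar.map_add_eq_mul, neg_add_cancel, AddChar.map_zero_eq_one]
        simp only [Set.indicator, Set.mem_ofPred_eq, hi, if_true, h3, Complex.one_re]
        linarith [hw0 s i]
      · simp only [Set.indicator, Set.mem_ofPred_eq, hi, if_false]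
        exact mul_nonneg (by linarith [(abs_le.1 (hre ψ (.ofMul (cl (q i))))).1]) (hw0 s i)
    · rw [AddChar.zero_apply, Complex.one_re, ← add_mul]
      exact mul_nonneg (by linarith [(abs_le.1 (hre ψ (.ofMul (cl (q i))))).1]) (hw0 s i)
  rw [(hsum 0 s hs1).tsum_add (hsum ψ s hs1)] at h2
  rw [abs_le] at h0 h1
  linarith

end TwistedSum

section LatticePoints

open MeasureTheory

theorem exists_abs_card_zspan_norm_le_sub_le {E ι : Type*} [NormedAddCommGroup E] [NormedSpace ℝ E]
    [FiniteDimensional ℝ E] [MeasurableSpace E] [BorelSpace E] [Finite ι]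
    (hE : Module.finrank ℝ E = 2) (b : Module.Basis ι ℝ E) :
    ∃ κ C : ℝ, ∀ R, 1 ≤ R →
      |(Nat.card {x : E // x ∈ Submodule.span ℤ (Set.range b) ∧ ‖x‖ ≤ R} : ℝ) - κ * R ^ 2| ≤
        C * R := by
  classical
  have : ProperSpace E := FiniteDimensional.proper ℝ E
  have := Fintype.ofFinite ι
  set μ : Measure E := Measure.addHaar
  set D := ZSpan.fundamentalDomain b
  have hDb : Bornology.IsBounded D := ZSpan.fundamentalDomain_isBounded b
  obtain ⟨ρ, hρ0, hρ⟩ := hDb.exists_pos_norm_le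
  have hD0 : 0 < μ.real D := ENNReal.toReal_pos (ZSpan.measure_fundamentalDomain_ne_zero b)
    hDb.measure_lt_top.ne
  set v := μ.real (Metric.ball (0 : E) 1)
  have hball : ∀ r, 0 ≤ r → μ.real (Metric.closedBall (0 : E) r) = r ^ 2 * v := fun r hr ↦ by
    rw [measureReal_def, Measure.addHaar_closedBall μ 0 hr, hE, ENNReal.toReal_mul,
      ENNReal.toReal_ofReal (by positivity)]
    rfl
  have hkey : ∀ R, 0 ≤ R → ∃ U : Set E, μ.real U =
      Nat.card {x : E // x ∈ Submodule.span ℤ (Set.range b) ∧ ‖x‖ ≤ R} * μ.real D ∧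
      U ⊆ Metric.closedBall 0 (R + ρ) ∧ ∀ r, r + ρ ≤ R → Metric.closedBall 0 r ⊆ U := by
    intro R hR
    have hfin : {x : E | x ∈ Submodule.span ℤ (Set.range b) ∧ ‖x‖ ≤ R}.Finite :=
      (ZSpan.setFinite_inter b (Metric.isBounded_closedBall (x := (0 : E)) (r := R))).subset
        fun x hx ↦ ⟨mem_closedBall_zero_iff.2 hx.2, hx.1⟩
    have hμ : ∀ x : E, μ ((· + -x) ⁻¹' D) = μ D := fun x ↦ measure_preimage_add_right _ _ _
    refine ⟨⋃ x ∈ hfin.toFinset, (· + -x) ⁻¹' D, ?_, ?_, ?_⟩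
    · rw [measureReal_biUnion_finset _ _ fun x _ ↦ (hμ x).trans_ne hDb.measure_lt_top.ne, Finset.sum_congr rfl (g := fun _ ↦ μ.real D),
        Finset.sum_const, nsmul_eq_mul, ← Nat.card_eq_card_finite_toFinset hfin]
      · rfl
      · exact fun x _ ↦ by rw [measureReal_def, hμ, measureReal_def]
      · intro x hx y hy hxy
        refine Set.disjoint_left.2 fun z hz hz' ↦ hxy ?_
        rw [Set.Finite.coe_toFinset] at hx hy
        have h1 : ∀ x ∈ Submodule.span ℤ (Set.range b), z + -x ∈ D → ZSpan.fract b z = z + -x := by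
          intro x hx hz
          rw [← ZSpan.fract_eq_self.2 hz, add_comm z, ZSpan.fract_zSpan_add b z (neg_mem hx)]
        have h2 := (h1 x hx.1 hz).symm.trans (h1 y hy.1 hz')
        simpa using h2
      · exact fun x _ ↦ (ZSpan.fundamentalDomain_measurableSet b).preimage (measurable_add_const _)
    · refine Set.iUnion₂_subset fun x hx y hy ↦ ?_
      rw [Set.Finite.mem_toFinset] at hx
      rw [mem_closedBall_zero_iff]
      calc ‖y‖ = ‖x + (y + -x)‖ := by congr 1; abel
        _ ≤ R + ρ := (norm_add_le _ _).trans (add_le_add hx.2 (hρ _ hy))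
    · intro r hr y hy
      rw [mem_closedBall_zero_iff] at hy
      have hy' : y + -(ZSpan.floor b y : E) = ZSpan.fract b y := by
        rw [ZSpan.fract_apply, sub_eq_add_neg]
      have hD : ZSpan.fract b y ∈ D := ZSpan.fract_mem_fundamentalDomain b y
      refine Set.mem_biUnion (x := (ZSpan.floor b y : E))
        (hfin.mem_toFinset.2 ⟨(ZSpan.floor b y).2, ?_⟩) ?_
      · calc ‖(ZSpan.floor b y : E)‖ = ‖y - ZSpan.fract b y‖ := by rw [← hy']; congr 1; abel
          _ ≤ r + ρ := (norm_sub_le _ _).trans (add_le_add hy (hρ _ hD))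
          _ ≤ R := hr
      · rw [Set.mem_preimage, hy']
        exact hD
  refine ⟨v / μ.real D, v / μ.real D * (2 * ρ + ρ ^ 2), fun R hR ↦ ?_⟩
  have hv : 0 ≤ v := measureReal_nonneg
  obtain ⟨U, hU, hU1, hU2⟩ := hkey R (by linarith)
  set n : ℝ := (Nat.card {x : E // x ∈ Submodule.span ℤ (Set.range b) ∧ ‖x‖ ≤ R} : ℝ)
  have hle : n * μ.real D ≤ (R + ρ) ^ 2 * v := by
    rw [← hU, ← hball _ (by positivity)]
    exact measureReal_mono hU1 Metric.isBounded_closedBall.measure_lt_top.ne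
  have hge : (R ^ 2 - 2 * R * ρ - ρ ^ 2) * v ≤ n * μ.real D := by
    rcases le_or_gt ρ R with h | h
    · have h1 := measureReal_mono (μ := μ) (hU2 (R - ρ) (by linarith))
        ((measure_mono hU1).trans_lt Metric.isBounded_closedBall.measure_lt_top).ne
      rw [hU, hball _ (by linarith)] at h1
      nlinarith [mul_nonneg (sq_nonneg ρ) hv]
    · have h1 : 0 ≤ n * μ.real D := by positivity
      have h2 : R ^ 2 - 2 * R * ρ - ρ ^ 2 ≤ 0 := by nlinarith
      nlinarith
  have h1 : ρ ^ 2 * v ≤ ρ ^ 2 * v * R := le_mul_of_one_le_right (by positivity) hR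
  have h2 : n - v / μ.real D * R ^ 2 = (n * μ.real D - v * R ^ 2) / μ.real D := by field_simp
  have h3 : v / μ.real D * (2 * ρ + ρ ^ 2) * R = v * (2 * ρ + ρ ^ 2) * R / μ.real D := by ring
  rw [h2, h3, abs_div, abs_of_pos hD0]
  gcongr
  rw [abs_le]
  constructor <;> nlinarith

end LatticePoints

section IdealCount

open NumberField NumberField.mixedEmbedding NumberField.mixedEmbedding.fundamentalCone
open NumberField.InfinitePlace NumberField.Units
open scoped nonZeroDivisors Classical

variable {F : Type*} [Field F] [NumberField F]

theorem card_absNorm_le_mk_eq {c : ClassGroup (𝓞 F)} {J : (Ideal (𝓞 F))⁰} {s : ℝ}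
    (hJ : ClassGroup.mk0 J = c⁻¹) :
    Nat.card {I : (Ideal (𝓞 F))⁰ // Ideal.absNorm (I : Ideal (𝓞 F)) ≤ s ∧ ClassGroup.mk0 I = c}
      = Nat.card {I : (Ideal (𝓞 F))⁰ // (J : Ideal (𝓞 F)) ∣ I ∧
        (I : Ideal (𝓞 F)).IsPrincipal ∧
        Ideal.absNorm (I : Ideal (𝓞 F)) ≤ s * Ideal.absNorm (J : Ideal (𝓞 F))} := by
  simp_rw [← nonZeroDivisors_dvd_iff_dvd_coe]
  refine Nat.card_congr ?_
  refine ((Equiv.dvd J).subtypeEquiv fun I ↦ ?_).trans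
    (Equiv.subtypeSubtypeEquivSubtypeInter (fun I : (Ideal (𝓞 F))⁰ ↦ J ∣ I) _)
  rw [← ClassGroup.mk0_eq_one_iff (SetLike.coe_mem _)]
  simp_rw [Equiv.dvd_apply, Submonoid.coe_mul, ← Submonoid.mul_def, map_mul, hJ,
    inv_mul_eq_one, Nat.cast_mul, mul_comm s, eq_comm, and_comm, and_congr_left_iff]
  exact fun _ ↦ (mul_le_mul_iff_of_pos_left
    (Nat.cast_pos.mpr (Ideal.absNorm_pos_of_nonZeroDivisors J))).symm

variable [IsTotallyComplex F]

theorem card_infinitePlace_eq_one (hF : Module.finrank ℚ F = 2) :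
    Fintype.card (InfinitePlace F) = 1 := by
  have h1 := IsTotallyComplex.finrank F
  have h2 := card_eq_nrRealPlaces_add_nrComplexPlaces F
  have h3 : nrRealPlaces F = 0 := nrRealPlaces_eq_zero_iff.mpr ‹_›
  omega

theorem mixedEmbedding_norm_eq_norm_sq (hF : Module.finrank ℚ F = 2) (x : mixedSpace F) :
    mixedEmbedding.norm x = ‖x‖ ^ 2 := by
  have := (Fintype.card_eq_one_iff_nonempty_unique.mp (card_infinitePlace_eq_one hF)).some
  rw [mixedEmbedding.norm_apply, norm_eq_sup'_normAtPlace]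
  simp [IsTotallyComplex.mult_eq]

theorem mem_fundamentalCone_iff_ne_zero (hF : Module.finrank ℚ F = 2) (x : mixedSpace F) :
    x ∈ fundamentalCone F ↔ x ≠ 0 := by
  have : IsEmpty (Fin (rank F)) := by
    have : rank F = 0 := by simp [rank, card_infinitePlace_eq_one hF]
    rw [this]; infer_instance
  have h0 : mixedEmbedding.norm x = 0 ↔ x = 0 := by simp [mixedEmbedding_norm_eq_norm_sq hF]
  rw [fundamentalCone, Set.mem_sdiff, Set.mem_ofPred_eq, h0, Set.mem_preimage,
    ZSpan.mem_fundamentalDomain]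
  simp

theorem card_idealSet_norm_le (hF : Module.finrank ℚ F = 2) (J : (Ideal (𝓞 F))⁰) {s : ℝ}
    (hs : 0 ≤ s) :
    Nat.card {a : idealSet F J // mixedEmbedding.norm (a : mixedSpace F) ≤ s} + 1 =
      Nat.card {x : mixedSpace F // x ∈ Submodule.span ℤ (Set.range
        (fractionalIdealLatticeBasis F (FractionalIdeal.mk0 F J))) ∧ ‖x‖ ≤ √s} := by
  have hfin : Set.Finite {x : mixedSpace F | x ∈ Submodule.span ℤ (Set.range
        (fractionalIdealLatticeBasis F (FractionalIdeal.mk0 F J))) ∧ ‖x‖ ≤ √s} := by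
    refine (ZSpan.setFinite_inter (fractionalIdealLatticeBasis F (FractionalIdeal.mk0 F J))
      (Metric.isBounded_closedBall (x := 0) (r := √s))).subset ?_
    rintro x ⟨h1, h2⟩
    exact ⟨by simpa using h2, h1⟩
  have h1 : Nat.card {a : idealSet F J // mixedEmbedding.norm (a : mixedSpace F) ≤ s} =
      ({x : mixedSpace F | x ∈ Submodule.span ℤ (Set.range
        (fractionalIdealLatticeBasis F (FractionalIdeal.mk0 F J))) ∧ ‖x‖ ≤ √s} \ {0}).ncard := by
    rw [← Nat.card_coe_set_eq]
    refine Nat.card_congr ((Equiv.subtypeSubtypeEquivSubtypeInter (· ∈ idealSet F J)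
      (mixedEmbedding.norm · ≤ s)).trans (Equiv.subtypeEquivRight fun x ↦ ?_))
    rw [idealSet, Set.mem_inter_iff, mem_fundamentalCone_iff_ne_zero hF,
      mixedEmbedding_norm_eq_norm_sq hF, span_idealLatticeBasis]
    simp only [Set.mem_sdiff, Set.mem_ofPred_eq, Set.mem_singleton_iff, SetLike.mem_coe,
      Real.le_sqrt (norm_nonneg x) hs]
    tauto
  rw [h1, Set.ncard_sdiff_singleton_add_one (by simp) hfin]
  rfl

theorem exists_abs_card_absNorm_le_mk_eq_sub_le (hF : Module.finrank ℚ F = 2)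
    (c : ClassGroup (𝓞 F)) :
    ∃ κ C : ℝ, ∀ s : ℝ, 1 ≤ s →
      |(Nat.card {I : (Ideal (𝓞 F))⁰ // Ideal.absNorm (I : Ideal (𝓞 F)) ≤ s ∧
        ClassGroup.mk0 I = c} : ℝ) - κ * s| ≤ C * √s := by
  obtain ⟨J, hJ⟩ := ClassGroup.mk0_surjective c⁻¹
  have hE : Module.finrank ℝ (mixedSpace F) = 2 := by rw [mixedEmbedding.finrank, hF]
  obtain ⟨κ, C, h⟩ := exists_abs_card_zspan_norm_le_sub_le hE
    (fractionalIdealLatticeBasis F (FractionalIdeal.mk0 F J))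
  set j : ℝ := ((Ideal.absNorm (J : Ideal (𝓞 F)) : ℕ) : ℝ) with hj
  have hj1 : 1 ≤ j := by
    rw [hj]; exact_mod_cast Ideal.absNorm_pos_of_nonZeroDivisors J
  set w : ℝ := ((torsionOrder F : ℕ) : ℝ) with hw
  have hw1 : 1 ≤ w := by
    rw [hw]; exact_mod_cast Nat.one_le_iff_ne_zero.mpr (torsionOrder_ne_zero F)
  refine ⟨κ * j / w, (C * √j + 1) / w, fun s hs ↦ ?_⟩
  have hsj : 1 ≤ s * j := one_le_mul_of_one_le_of_one_le hs hj1
  have h1 := h √(s * j) (Real.one_le_sqrt.mpr hsj)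
  rw [← card_idealSet_norm_le hF J (by positivity), ← card_isPrincipal_dvd_norm_le,
    ← card_absNorm_le_mk_eq hJ, Real.sq_sqrt (by positivity), Real.sqrt_mul (by positivity)] at h1
  push_cast at h1
  set N : ℝ := (Nat.card {I : (Ideal (𝓞 F))⁰ // Ideal.absNorm (I : Ideal (𝓞 F)) ≤ s ∧
        ClassGroup.mk0 I = c} : ℝ) with hN
  have hs' : 1 ≤ √s := Real.one_le_sqrt.mpr hs
  have h2 : N - κ * j / w * s = (N * w - κ * (s * j)) / w := by field_simp
  rw [h2, abs_div, abs_of_pos (by positivity : 0 < w), div_mul_eq_mul_div]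
  gcongr
  rw [abs_le] at h1 ⊢
  constructor <;> nlinarith

open Filter Topology in
theorem exists_forall_abs_card_absNorm_le_mk_eq_sub_le (hF : Module.finrank ℚ F = 2) :
    ∃ κ C : ℝ, 0 < κ ∧ ∀ (c : ClassGroup (𝓞 F)) (n : ℕ),
      |(Nat.card {I : (Ideal (𝓞 F))⁰ // Ideal.absNorm (I : Ideal (𝓞 F)) ≤ n ∧
        ClassGroup.mk0 I = c} : ℝ) - κ * n| ≤ C * (n : ℝ) ^ (1 / 2 : ℝ) := by
  choose κ C h using exists_abs_card_absNorm_le_mk_eq_sub_le (F := F) hF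
  have hκ (c) : κ c = (2 ^ nrRealPlaces F * (2 * Real.pi) ^ nrComplexPlaces F * regulator F) /
            (torsionOrder F * Real.sqrt |discr F|) := by
    refine tendsto_nhds_unique ?_ (Ideal.tendsto_norm_le_and_mk_eq_div_atTop F c)
    rw [tendsto_iff_norm_sub_tendsto_zero]
    have h0 : Tendsto (fun s : ℝ ↦ C c * (√s)⁻¹) atTop (𝓝 0) := by
      simpa using (tendsto_inv_atTop_zero.comp Real.tendsto_sqrt_atTop).const_mul (C c)
    refine squeeze_zero' (.of_forall fun _ ↦ norm_nonneg _) ?_ h0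
    filter_upwards [eventually_ge_atTop 1] with s hs
    have := h c s hs
    have hs0 : 0 < s := by linarith
    rw [show ∀ a : ℝ, a / s - κ c = (a - κ c * s) / s by intro a; field_simp, norm_div,
      Real.norm_eq_abs, Real.norm_of_nonneg hs0.le, div_le_iff₀ hs0]
    refine this.trans_eq ?_
    nth_rw 3 [← Real.mul_self_sqrt hs0.le]
    have : √s ≠ 0 := by positivity
    field_simp
  refine ⟨(2 ^ nrRealPlaces F * (2 * Real.pi) ^ nrComplexPlaces F * regulator F) /
            (torsionOrder F * Real.sqrt |discr F|), ∑ c, |C c|, ?_, fun c n ↦ ?_⟩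
  · have := regulator_pos F
    have := Real.pi_pos
    have : (0 : ℝ) < torsionOrder F := by
      exact_mod_cast Nat.pos_of_ne_zero (torsionOrder_ne_zero F)
    have : (0 : ℝ) < |(discr F : ℝ)| := abs_pos.mpr (by exact_mod_cast discr_ne_zero F)
    positivity
  rw [← Real.sqrt_eq_rpow]
  rcases n.eq_zero_or_pos with rfl | hn
  · have : IsEmpty {I : (Ideal (𝓞 F))⁰ // Ideal.absNorm (I : Ideal (𝓞 F)) ≤ 0 ∧
        ClassGroup.mk0 I = c} :=
      ⟨fun I ↦ (Ideal.absNorm_pos_of_nonZeroDivisors I.1).not_ge I.2.1⟩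
    rw [Nat.card_of_isEmpty]
    simp
  · have := h c n (by exact_mod_cast hn)
    rw [hκ] at this
    simp only [Nat.cast_le] at this
    refine this.trans ?_
    gcongr
    exact (le_abs_self _).trans
      (Finset.single_le_sum (f := fun c ↦ |C c|) (fun _ _ ↦ abs_nonneg _) (Finset.mem_univ c))

end IdealCount

theorem ZMod.exists_sq_eq_neg_of_mod_eq_one {m p : ℕ} [Fact p.Prime]
    (hp : p % (4 * m) = 1) : ∃ r : ℤ, (p : ℤ) ∣ r ^ 2 + m := by
  have hodd : Odd p := by
    rw [Nat.odd_iff, ← Nat.mod_mul_right_mod p 2 (2 * m), ← mul_assoc]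
    norm_num [hp]
  have h1 : jacobiSym (-m) p = 1 := by
    rw [jacobiSym.mod_right _ hodd]
    simp [hp]
  obtain ⟨x, hx⟩ := ZMod.isSquare_of_jacobiSym_eq_one h1
  obtain ⟨r, rfl⟩ := ZMod.intCast_surjective x
  refine ⟨r, (ZMod.intCast_zmod_eq_zero_iff_dvd _ p).mp ?_⟩
  push_cast at hx ⊢
  linear_combination -hx

/-- Thue's lemma with a second congruence. -/
theorem Int.exists_small_solution_congruences (p m : ℕ) [NeZero p] [NeZero m] (r : ℤ) :
    ∃ x y z : ℤ, (x, y, z) ≠ 0 ∧ (p : ℤ) ∣ x - r * y ∧ (m : ℤ) ∣ x - z ∧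
      x ^ 2 ≤ p * m ∧ y ^ 2 ≤ p ∧ z ^ 2 ≤ m := by
  set A := (p * m).sqrt
  set B := p.sqrt
  set C := m.sqrt
  let S : Finset (ℤ × ℤ × ℤ) := Finset.Icc 0 (A : ℤ) ×ˢ Finset.Icc 0 (B : ℤ) ×ˢ Finset.Icc 0 (C : ℤ)
  let f : ℤ × ℤ × ℤ → ZMod p × ZMod m := fun v ↦
    (((v.1 - r * v.2.1 : ℤ) : ZMod p), ((v.1 - v.2.2 : ℤ) : ZMod m))
  have hcard : (Finset.univ : Finset (ZMod p × ZMod m)).card < S.card := by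
    have hS : S.card = (A + 1) * ((B + 1) * (C + 1)) := by
      simp [S, Finset.card_product]
    rw [hS, Finset.card_univ, Fintype.card_prod, ZMod.card, ZMod.card]
    have h1 : p * m < (A + 1) * (A + 1) := Nat.lt_succ_sqrt _
    have h2 : p < (B + 1) * (B + 1) := Nat.lt_succ_sqrt _
    have h3 : m < (C + 1) * (C + 1) := Nat.lt_succ_sqrt _
    refine lt_of_pow_lt_pow_left₀ 2 (by positivity) ?_
    calc (p * m) ^ 2 = (p * m) * (p * m) := sq _
      _ < ((A + 1) * (A + 1)) * (((B + 1) * (B + 1)) * ((C + 1) * (C + 1))) := by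
        gcongr
      _ = _ := by ring
  obtain ⟨u, hu, v, hv, huv, h⟩ := Finset.exists_ne_map_eq_of_card_lt_of_maps_to hcard
    (f := f) (fun _ _ ↦ Finset.mem_univ _)
  simp only [S, Finset.mem_product, Finset.mem_Icc] at hu hv
  simp only [f, Prod.mk.injEq, ZMod.intCast_eq_intCast_iff_dvd_sub] at h
  have key {a b : ℤ} {n : ℕ} (ha : 0 ≤ a ∧ a ≤ n.sqrt) (hb : 0 ≤ b ∧ b ≤ n.sqrt) :
      (a - b) ^ 2 ≤ n := by
    have : ((n.sqrt * n.sqrt : ℕ) : ℤ) ≤ n := by exact_mod_cast Nat.sqrt_le n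
    push_cast at this
    refine le_trans ?_ this
    rw [← sq]
    exact sq_le_sq' (by linarith [ha.1, hb.2]) (by linarith [ha.2, hb.1])
  refine ⟨v.1 - u.1, v.2.1 - u.2.1, v.2.2 - u.2.2, ?_, ?_, ?_, ?_, ?_, ?_⟩
  · intro h0
    simp only [Prod.mk_eq_zero, sub_eq_zero] at h0
    exact huv (Prod.ext h0.1.symm (Prod.ext h0.2.1.symm h0.2.2.symm))
  · convert h.1 using 1; ring
  · convert h.2 using 1; ring
  · exact_mod_cast key hv.1 hu.1
  · exact key hv.2.1 hu.2.1
  · exact key hv.2.2 hu.2.2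

/-- A prime in the principal residue class modulo `4 * m` lies in the principal genus of the
form `x ^ 2 + m * y ^ 2`. -/
theorem Nat.Prime.exists_sq_add_mul_sq_eq_mul_sq {m p : ℕ} (hp : p.Prime) (hm : 2 ≤ m)
    (hpm : p % (4 * m) = 1) : ∃ x y z : ℤ, z ≠ 0 ∧ x ^ 2 + m * y ^ 2 = p * z ^ 2 := by
  have : Fact p.Prime := ⟨hp⟩
  have : NeZero m := ⟨by omega⟩
  have hm1 : p % m = 1 := by
    rw [← Nat.mod_mul_left_mod p 4 m, hpm, Nat.mod_eq_of_lt hm]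
  obtain ⟨r, hr⟩ := ZMod.exists_sq_eq_neg_of_mod_eq_one hpm
  obtain ⟨x, y, z, h0, h1, h2, hx, hy, hz⟩ := Int.exists_small_solution_congruences p m r
  have hpp : (0 : ℤ) < p := by exact_mod_cast hp.pos
  have hmm : (2 : ℤ) ≤ m := by exact_mod_cast hm
  have hd1 : (p : ℤ) ∣ x ^ 2 + m * y ^ 2 - p * z ^ 2 := by
    obtain ⟨a, ha⟩ := h1
    obtain ⟨b, hb⟩ := hr
    exact ⟨a * (x + r * y) + b * y ^ 2 - z ^ 2, by linear_combination (x + r * y) * ha + y ^ 2 * hb⟩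
  have hd2 : (m : ℤ) ∣ x ^ 2 + m * y ^ 2 - p * z ^ 2 := by
    obtain ⟨a, ha⟩ := h2
    have h3 := Nat.div_add_mod p m
    rw [hm1] at h3
    have h4 : (m : ℤ) * (p / m : ℕ) + 1 = p := by exact_mod_cast h3
    exact ⟨a * (x + z) + y ^ 2 - (p / m : ℕ) * z ^ 2, by
      linear_combination (x + z) * ha + z ^ 2 * h4⟩
  have hcop : IsCoprime (p : ℤ) m := by
    rw [Nat.isCoprime_iff_coprime, Nat.coprime_comm, Nat.Coprime, Nat.gcd_rec, hm1, Nat.gcd_one_left]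
  obtain ⟨k, hk⟩ := hcop.mul_dvd hd1 hd2
  have hk1 : -1 ≤ k := by
    by_contra! h
    nlinarith [sq_nonneg x, sq_nonneg y, mul_pos hpp (by linarith : (0 : ℤ) < m)]
  have hk2 : k ≤ 2 := by
    by_contra! h
    nlinarith [sq_nonneg z, mul_pos hpp (by linarith : (0 : ℤ) < m)]
  have hpm0 : (0 : ℤ) < p * m := by positivity
  obtain rfl | rfl | rfl | rfl : k = -1 ∨ k = 0 ∨ k = 1 ∨ k = 2 := by omega
  · exfalso
    have hx0 : x = 0 := by nlinarith [sq_nonneg x, sq_nonneg y]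
    have hz0 : z ^ 2 = m := by nlinarith [sq_nonneg x, sq_nonneg y]
    subst hx0
    rw [zero_sub, dvd_neg] at h2
    have h3 := mul_dvd_mul h2 h2
    rw [← sq z, hz0] at h3
    have := Int.le_of_dvd (by linarith) h3
    nlinarith
  · refine ⟨x, y, z, ?_, by linarith⟩
    rintro rfl
    have hx0 : x = 0 := by nlinarith [sq_nonneg x, sq_nonneg y]
    have hy0 : y = 0 := by nlinarith [sq_nonneg x, sq_nonneg y]
    exact h0 (by simp [hx0, hy0])
  · exact ⟨x * z + m * y, y * z - x, z ^ 2 + m, by positivity, by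
      linear_combination (z ^ 2 + m) * hk⟩
  · exfalso
    have hy0 : y ^ 2 = p := by nlinarith [sq_nonneg x, sq_nonneg y, sq_nonneg z]
    have : IsSquare (p : ℤ) := ⟨y, by rw [← hy0, sq]⟩
    exact (Nat.prime_iff_prime_int.mp hp).irreducible.not_isSquare this

section Conjugation

open scoped nonZeroDivisors

theorem map_map_eq_self_of_add_map_eq_intCast {R : Type*} [CommRing R] {c : R ≃+* R}
    (htr : ∀ a, ∃ k : ℤ, a + c a = k) (a : R) : c (c a) = a := by
  obtain ⟨k, hk⟩ := htr a
  have := congrArg c hk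
  rw [map_add, map_intCast, ← hk] at this
  linear_combination this

variable {R : Type*} [CommRing R] [IsDedekindDomain R] [CharZero R] {c : R ≃+* R}

theorem intCast_dvd_of_sq_eq {x : R} {n t k : ℤ} (hn : n ≠ 0)
    (h : x ^ 2 - n * t * x + n ^ 2 * k = 0) : (n : R) ∣ x := by
  have hn' : (n : FractionRing R) ≠ 0 := by
    rw [← map_intCast (algebraMap R (FractionRing R)), Ne, FaithfulSMul.algebraMap_eq_zero_iff]
    exact_mod_cast hn
  have h' := congrArg (algebraMap R (FractionRing R)) h
  simp only [map_add, map_sub, map_mul, map_pow, map_intCast, map_zero] at h'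
  have hint : IsIntegral R (algebraMap R (FractionRing R) x / n) := by
    refine ⟨Polynomial.X ^ 2 + (Polynomial.C (-t : R) * Polynomial.X + Polynomial.C (k : R)),
      Polynomial.monic_X_pow_add (by compute_degree!), ?_⟩
    simp only [Polynomial.eval₂_add, Polynomial.eval₂_mul, Polynomial.eval₂_pow,
      Polynomial.eval₂_X, Polynomial.eval₂_C]
    simp only [map_neg, map_intCast]
    field_simp
    linear_combination h'
  obtain ⟨y, hy⟩ := IsIntegrallyClosed.isIntegral_iff.mp hint
  refine ⟨y, FaithfulSMul.algebraMap_injective R (FractionRing R) ?_⟩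
  rw [map_mul, map_intCast, hy]
  field_simp

/-- If traces and norms of elements are integers, then so are norms of ideals. -/
theorem exists_mul_map_eq_span_intCast (htr : ∀ a, ∃ k : ℤ, a + c a = k)
    (hnm : ∀ a, ∃ k : ℤ, a * c a = k) (I : Ideal R) :
    ∃ n : ℤ, I * I.map c = Ideal.span {(n : R)} := by
  let A : Ideal ℤ := (I * I.map c).comap (Int.castRingHom R)
  obtain ⟨n, hn⟩ : ∃ n, A = Ideal.span {n} := IsPrincipalIdealRing.principal A |>.principal
  have hmem (k : ℤ) : (k : R) ∈ I * I.map c ↔ n ∣ k := by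
    rw [← Ideal.mem_span_singleton, ← hn]; rfl
  refine ⟨n, le_antisymm ?_ ?_⟩
  · rw [Ideal.mul_le]
    intro a ha b' hb'
    obtain ⟨b, hb, rfl⟩ := (Ideal.mem_map_of_equiv c b').mp hb'
    have hmulmem {u v : R} (hu : u ∈ I) (hv : v ∈ I) : u * c v ∈ I * I.map c :=
      Ideal.mul_mem_mul hu (Ideal.mem_map_of_mem c hv)
    obtain ⟨i, hi⟩ := hnm a
    obtain ⟨j, hj⟩ := hnm b
    obtain ⟨k, hk⟩ := htr (a * c b)
    have hi' := hmulmem ha ha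
    have hj' := hmulmem hb hb
    have hk' : a * c b + b * c a ∈ I * I.map c := add_mem (hmulmem ha hb) (hmulmem hb ha)
    rw [map_mul, map_map_eq_self_of_add_map_eq_intCast htr, mul_comm (c a)] at hk
    rw [hi, hmem] at hi'
    rw [hj, hmem] at hj'
    rw [hk, hmem] at hk'
    obtain ⟨i, rfl⟩ := hi'
    obtain ⟨j, rfl⟩ := hj'
    obtain ⟨k, rfl⟩ := hk'
    push_cast at hi hj hk
    rw [Ideal.mem_span_singleton]
    rcases eq_or_ne n 0 with rfl | hn0
    · simp only [Int.cast_zero, zero_mul, mul_eq_zero, map_eq_zero_iff c c.injective,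
        or_self] at hi
      simp [hi]
    · refine intCast_dvd_of_sq_eq (t := k) (k := i * j) hn0 ?_
      push_cast
      linear_combination (a * c b) * hk - (b * c b) * hi - n * i * hj
  · rw [Ideal.span_singleton_le_iff_mem, hmem]

/-- Ideals with the same norm are in the same genus. -/
theorem exists_mk0_eq_mul_sq_of_mul_map_eq (htr : ∀ a, ∃ k : ℤ, a + c a = k)
    (hnm : ∀ a, ∃ k : ℤ, a * c a = k) {I J : (Ideal R)⁰}
    (h : (I : Ideal R) * (I : Ideal R).map c = J * (J : Ideal R).map c) :
    ∃ g, ClassGroup.mk0 J = ClassGroup.mk0 I * g ^ 2 := by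
  have hmap0 {A : Ideal R} (hA : A ≠ 0) : A.map c ≠ 0 := fun h ↦
    hA ((Ideal.map_eq_bot_iff_of_injective c.injective).mp h)
  obtain ⟨I, hI⟩ := I
  obtain ⟨J, hJ⟩ := J
  simp only at h
  obtain ⟨d, hd⟩ : ∃ d, d = I ⊔ J := ⟨_, rfl⟩
  obtain ⟨I', rfl⟩ : d ∣ I := Ideal.dvd_iff_le.mpr (hd ▸ le_sup_left)
  obtain ⟨J', rfl⟩ : d ∣ J := Ideal.dvd_iff_le.mpr (hd ▸ le_sup_right)
  have hI0 := nonZeroDivisors.ne_zero hI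
  have hJ0 := nonZeroDivisors.ne_zero hJ
  have hd0 : d ≠ 0 := left_ne_zero_of_mul hI0
  have hI'0 : I' ≠ 0 := right_ne_zero_of_mul hI0
  have hJ'0 : J' ≠ 0 := right_ne_zero_of_mul hJ0
  have hcop : IsCoprime I' J' := by
    rw [Ideal.isCoprime_iff_sup_eq]
    rw [← Ideal.mul_sup] at hd
    exact mul_left_cancel₀ hd0 (by rw [← hd, Ideal.mul_top])
  have hcop' : IsCoprime J' I' := hcop.symm
  rw [Ideal.map_mul, Ideal.map_mul] at h
  have h' : I' * I'.map c = J' * J'.map c := by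
    refine mul_left_cancel₀ (mul_ne_zero hd0 (hmap0 hd0)) ?_
    rw [mul_mul_mul_comm, h, mul_mul_mul_comm]
  have h1 : I' ∣ J'.map c := hcop.dvd_of_dvd_mul_left (h' ▸ dvd_mul_right _ _)
  have h2 : J' ∣ I'.map c := hcop'.dvd_of_dvd_mul_left (h' ▸ dvd_mul_right _ _)
  have h3 : J'.map c ∣ I' := by
    rw [Ideal.dvd_iff_le] at h2 ⊢
    have := Ideal.map_mono (f := c) h2
    refine le_trans (fun a ha ↦ ?_) this
    rw [← map_map_eq_self_of_add_map_eq_intCast htr a]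
    exact Ideal.mem_map_of_mem c (Ideal.mem_map_of_mem c ha)
  have h5 : I' = J'.map c := dvd_antisymm h1 h3
  obtain ⟨n, hn⟩ := exists_mul_map_eq_span_intCast htr hnm J'
  refine ⟨ClassGroup.mk0 ⟨J', mem_nonZeroDivisors_of_ne_zero hJ'0⟩, ?_⟩
  have e1 : (⟨d * I', hI⟩ : (Ideal R)⁰) = ⟨d, mem_nonZeroDivisors_of_ne_zero hd0⟩ *
    ⟨I', mem_nonZeroDivisors_of_ne_zero hI'0⟩ := rfl
  have e2 : (⟨d * J', hJ⟩ : (Ideal R)⁰) = ⟨d, mem_nonZeroDivisors_of_ne_zero hd0⟩ *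
    ⟨J', mem_nonZeroDivisors_of_ne_zero hJ'0⟩ := rfl
  have e3 : ClassGroup.mk0 ⟨J', mem_nonZeroDivisors_of_ne_zero hJ'0⟩ *
      ClassGroup.mk0 ⟨I', mem_nonZeroDivisors_of_ne_zero hI'0⟩ = 1 := by
    rw [← map_mul, ClassGroup.mk0_eq_one_iff]
    change (J' * I').IsPrincipal
    rw [h5, hn]
    exact ⟨_, rfl⟩
  rw [e1, e2, map_mul, map_mul, mul_assoc, sq, ← mul_assoc (ClassGroup.mk0 ⟨I', _⟩),
    mul_comm (ClassGroup.mk0 ⟨I', _⟩), e3, one_mul]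

/-- Above a prime `p ≡ 1 mod 4 * m` there are primes of the principal genus in a ring containing
a square root of `-m`. -/
theorem exists_mul_map_eq_span_and_isSquare_mk0 (htr : ∀ a, ∃ k : ℤ, a + c a = k)
    (hnm : ∀ a, ∃ k : ℤ, a * c a = k) {δ : R} {m p : ℕ} (hδ : δ ^ 2 = -m) (hcδ : c δ = -δ)
    (hm : 2 ≤ m) (hp : p.Prime) (hpm : p % (4 * m) = 1) :
    ∃ P : (Ideal R)⁰, (P : Ideal R) * (P : Ideal R).map c = Ideal.span {(p : R)} ∧
      IsSquare (ClassGroup.mk0 P) := by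
  have : Fact p.Prime := ⟨hp⟩
  obtain ⟨r, s, hr⟩ := ZMod.exists_sq_eq_neg_of_mod_eq_one hpm
  obtain ⟨x, y, z, hz, hxyz⟩ := hp.exists_sq_add_mul_sq_eq_mul_sq hm hpm
  have hp0 : (p : R) ≠ 0 := by exact_mod_cast hp.ne_zero
  have hz0 : (z : R) ≠ 0 := by exact_mod_cast hz
  have hr' : (r : R) ^ 2 + m = p * s := by exact_mod_cast congrArg (Int.cast : ℤ → R) hr
  have hxyz' : (x : R) ^ 2 + m * y ^ 2 = p * z ^ 2 := by
    exact_mod_cast congrArg (Int.cast : ℤ → R) hxyz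
  have hcop : IsCoprime (p : ℤ) (2 * r) := by
    have hp4 : 4 * m < p := by
      by_contra! h
      rcases h.eq_or_lt with h | h
      · simp [h] at hpm
      · rw [Nat.mod_eq_of_lt h] at hpm
        exact hp.one_lt.ne' hpm
    rw [(Nat.prime_iff_prime_int.mp hp).coprime_iff_not_dvd]
    intro h
    rcases (Nat.prime_iff_prime_int.mp hp).dvd_or_dvd h with h | h
    · have := Int.le_of_dvd two_pos h
      omega
    · have h1 : (p : ℤ) ∣ m := (Int.dvd_add_right (h.mul_left r)).mp ⟨s, by rw [← hr, sq]⟩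
      have := Int.le_of_dvd (by omega) h1
      omega
  set P : Ideal R := Ideal.span {(p : R), r + δ} with hP
  have hPc : P.map c = Ideal.span {(p : R), r - δ} := by
    rw [hP, Ideal.map_span, Set.image_pair, map_natCast, map_add, map_intCast, hcδ, sub_eq_add_neg]
  have hmul : P * P.map c = Ideal.span {(p : R)} := by
    rw [hPc, hP, Ideal.span_pair_mul_span_pair]
    refine le_antisymm ?_ ?_
    · rw [Ideal.span_le]
      rintro u (rfl | rfl | rfl | rfl) <;>
        rw [SetLike.mem_coe, Ideal.mem_span_singleton]
      · exact dvd_mul_right _ _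
      · exact dvd_mul_right _ _
      · exact dvd_mul_left _ _
      · exact ⟨s, by linear_combination hr' - hδ⟩
    · rw [Ideal.span_singleton_le_iff_mem]
      obtain ⟨a, b, hab⟩ := hcop
      have hab' : (a : R) * p + b * (2 * r) = 1 := by exact_mod_cast congrArg (Int.cast : ℤ → R) hab
      have : (p : R) = a * (p * p) + b * (p * (r - δ)) + b * ((r + δ) * p) := by
        linear_combination (-p : R) * hab'
      have hsub {u : R} (hu : u ∈ ({(p : R) * p, p * (r - δ), (r + δ) * p, (r + δ) * (r - δ)} : Set R)) :=
        Ideal.subset_span hu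
      convert add_mem (add_mem (Ideal.mul_mem_left _ (a : R) (hsub (u := p * p) (by simp)))
        (Ideal.mul_mem_left _ (b : R) (hsub (u := p * (r - δ)) (by simp))))
        (Ideal.mul_mem_left _ (b : R) (hsub (u := (r + δ) * p) (by simp)))
  have hP0 : P ≠ 0 := by
    rintro h
    rw [h, zero_mul, eq_comm, Ideal.zero_eq_bot, Ideal.span_singleton_eq_bot] at hmul
    exact hp0 hmul
  set γ : R := x + y * δ with hγ
  have hcγ : γ * c γ = p * z ^ 2 := by
    rw [hγ, map_add, map_mul, map_intCast, map_intCast, hcδ]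
    linear_combination hxyz' - y ^ 2 * hδ
  have hγ0 : γ ≠ 0 := by
    intro h
    rw [h, zero_mul, eq_comm] at hcγ
    exact mul_ne_zero hp0 (pow_ne_zero 2 hz0) hcγ
  have hspan {a : R} (ha : a ≠ 0) : Ideal.span {a} ∈ (Ideal R)⁰ := by
    simpa using ha
  refine ⟨⟨P, mem_nonZeroDivisors_of_ne_zero hP0⟩, hmul, ?_⟩
  obtain ⟨g, hg⟩ := exists_mk0_eq_mul_sq_of_mul_map_eq htr hnm
    (I := ⟨Ideal.span {γ}, hspan hγ0⟩)
    (J := ⟨P, mem_nonZeroDivisors_of_ne_zero hP0⟩ * ⟨Ideal.span {(z : R)}, hspan hz0⟩) (by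
      rw [Submonoid.coe_mul, Ideal.map_mul, mul_mul_mul_comm]
      simp only
      rw [hmul, Ideal.map_span, Ideal.map_span, Set.image_singleton, Set.image_singleton,
        map_intCast, Ideal.span_singleton_mul_span_singleton,
        Ideal.span_singleton_mul_span_singleton, Ideal.span_singleton_mul_span_singleton, hcγ, sq])
  have hone {a : R} (ha : a ≠ 0) : ClassGroup.mk0 ⟨Ideal.span {a}, hspan ha⟩ = 1 := by
    rw [ClassGroup.mk0_eq_one_iff]
    exact ⟨_, rfl⟩
  rw [map_mul, hone hγ0, hone hz0, mul_one, one_mul] at hg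
  exact ⟨g, by rw [hg, sq]⟩

end Conjugation

open ArithmeticFunction.vonMangoldt Filter Topology in
/-- The sum of the reciprocals of the primes in an invertible residue class diverges. -/
theorem not_summable_indicator_prime_residueClass {q : ℕ} [NeZero q] {a : ZMod q}
    (ha : IsUnit a) :
    ¬ Summable ({p : ℕ | p.Prime ∧ (p : ZMod q) = a}.indicator fun p ↦ (p : ℝ)⁻¹) := by
  intro hsum
  obtain ⟨C, hC⟩ := LSeries_residueClass_lower_bound ha
  set b : ℕ → ℝ := {p : ℕ | p.Prime ∧ (p : ZMod q) = a}.indicator fun p ↦ (p : ℝ)⁻¹ with hb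
  have hb0 (n : ℕ) : 0 ≤ b n := Set.indicator_nonneg (fun _ _ ↦ by positivity) n
  have hbound := hsum.add (summable_residueClass_non_primes_div a)
  have hle : ∀ᶠ t : ℝ in 𝓝[>] 0, ∀ n : ℕ, ‖t * (residueClass a n / (n : ℝ) ^ (1 + t))‖ ≤
      b n + (if n.Prime then 0 else residueClass a n) / n := by
    filter_upwards [Ioc_mem_nhdsGT zero_lt_one] with t ht n
    have ht0 : 0 < t := ht.1
    rcases n.eq_zero_or_pos with rfl | hn
    · simpa using hb0 0
    have hn0 : (0 : ℝ) < n := by exact_mod_cast hn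
    have hn1 : (1 : ℝ) ≤ n := by exact_mod_cast hn
    have h0 := residueClass_nonneg a n
    rw [Real.norm_of_nonneg (by positivity)]
    split_ifs with hp
    · rw [zero_div, add_zero]
      by_cases hpa : (n : ZMod q) = a
      · have hmem : n ∈ {p : ℕ | p.Prime ∧ (p : ZMod q) = a} := ⟨hp, hpa⟩
        rw [hb, Set.indicator_of_mem hmem, residueClass,
          Set.indicator_of_mem (by exact hpa), ArithmeticFunction.vonMangoldt_apply_prime hp,
          Real.rpow_add hn0, Real.rpow_one]
        have := Real.log_le_rpow_div hn0.le ht0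
        rw [le_div_iff₀ ht0] at this
        rw [← mul_div_assoc, div_le_iff₀ (by positivity), inv_mul_cancel_left₀ hn0.ne']
        linarith
      · rw [residueClass, Set.indicator_of_notMem (by exact hpa)]
        simpa using hb0 n
    · refine le_add_of_nonneg_of_le (hb0 n) ?_
      have h1 : (n : ℝ) ≤ (n : ℝ) ^ (1 + t) := Real.self_le_rpow_of_one_le hn1 (by linarith)
      calc t * (residueClass a n / (n : ℝ) ^ (1 + t))
          ≤ 1 * (residueClass a n / n) := by
            gcongr
            exact ht.2
        _ = _ := one_mul _
  have hlim : ∀ n : ℕ, Tendsto (fun t : ℝ ↦ t * (residueClass a n / (n : ℝ) ^ (1 + t)))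
      (𝓝[>] 0) (𝓝 0) := by
    intro n
    refine tendsto_nhdsWithin_of_tendsto_nhds ?_
    rcases n.eq_zero_or_pos with rfl | hn
    · simp
    have hn0 : (0 : ℝ) < n := by exact_mod_cast hn
    have : ContinuousAt (fun t : ℝ ↦ t * (residueClass a n / (n : ℝ) ^ (1 + t))) 0 := by
      have h1 : Continuous fun t : ℝ ↦ (n : ℝ) ^ (1 + t) :=
        (Real.continuous_const_rpow hn0.ne').comp (by fun_prop)
      exact continuousAt_id.mul (continuousAt_const.div h1.continuousAt (by positivity))
    simpa [ContinuousAt] using this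
  have h := tendsto_tsum_of_dominated_convergence hbound hlim hle
  rw [tsum_zero] at h
  have h2 : Tendsto (fun t : ℝ ↦ (q.totient : ℝ)⁻¹ - C * t) (𝓝[>] 0) (𝓝 ((q.totient : ℝ)⁻¹)) := by
    refine tendsto_nhdsWithin_of_tendsto_nhds ?_
    have : ContinuousAt (fun t : ℝ ↦ (q.totient : ℝ)⁻¹ - C * t) 0 := by fun_prop
    simpa [ContinuousAt] using this
  have h3 := le_of_tendsto_of_tendsto h2 h (by
    filter_upwards [Ioc_mem_nhdsGT zero_lt_one] with t ht
    have := hC (x := 1 + t) ⟨by linarith [ht.1], by linarith [ht.2]⟩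
    rw [tsum_mul_left]
    refine le_trans (le_of_eq ?_) (mul_le_mul_of_nonneg_left this ht.1.le)
    have := ht.1.ne'
    rw [add_sub_cancel_left]
    field_simp)
  have hq : 0 < (q.totient : ℝ)⁻¹ := inv_pos.mpr (mod_cast q.totient.pos_of_neZero)
  linarith

section ConjugationNorm

variable {R : Type*} [CommRing R] {c : R ≃+* R}

theorem map_ne_self_of_mul_map_eq_prime [CharZero R] (htr : ∀ a, ∃ k : ℤ, a + c a = k) {a : R}
    {p : ℕ} (hp : p.Prime) (ha : a * c a = p) : c a ≠ a := by
  intro h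
  obtain ⟨k, hk⟩ := htr a
  have h1 : k ^ 2 = 2 * (2 * p : ℤ) := by
    have : (k : R) ^ 2 = 2 * (2 * p) := by
      rw [← hk, ← ha, h]; ring
    exact_mod_cast this
  obtain ⟨l, rfl⟩ := Int.prime_two.dvd_of_dvd_pow ⟨_, h1⟩
  have h2 : (p : ℤ) = l * l := by linarith
  exact (Nat.prime_iff_prime_int.mp hp).irreducible.not_isSquare ⟨l, h2⟩

theorem le_of_map_eq_neg_of_mul_map_eq_prime [CharZero R] (htr : ∀ a, ∃ k : ℤ, a + c a = k)
    {δ : R} {m : ℕ} (hm : m ≠ 0) (hδ : δ ^ 2 = -m) (hcδ : c δ = -δ) {a : R}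
    {p : ℕ} (hp : p.Prime) (ha : a * c a = p) (h : c a = -a) : p ≤ m := by
  obtain ⟨k, hk⟩ := htr (a * δ)
  have h1 : k ^ 2 = 2 * (2 * (p * m) : ℤ) := by
    have : (k : R) ^ 2 = 2 * (2 * (p * m)) := by
      rw [← hk, ← ha, map_mul, h, hcδ]
      linear_combination 4 * a ^ 2 * hδ
    exact_mod_cast this
  obtain ⟨l, rfl⟩ := Int.prime_two.dvd_of_dvd_pow ⟨_, h1⟩
  have h2 : l ^ 2 = p * m := by linarith
  have hp' := Nat.prime_iff_prime_int.mp hp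
  obtain ⟨j, rfl⟩ := hp'.dvd_of_dvd_pow ⟨_, h2⟩
  have h3 : (p : ℤ) * j ^ 2 = m := mul_left_cancel₀ hp'.ne_zero (by linarith)
  exact Nat.le_of_dvd (Nat.pos_of_ne_zero hm) (Int.natCast_dvd_natCast.mp ⟨_, h3.symm⟩)

variable [IsDedekindDomain R] [Module.Free ℤ R]

theorem absNorm_map_equiv (c : R ≃+* R) (I : Ideal R) :
    Ideal.absNorm (I.map c) = Ideal.absNorm I := by
  rw [Ideal.absNorm_apply, Ideal.absNorm_apply, Submodule.cardQuot_apply,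
    Submodule.cardQuot_apply]
  exact Nat.card_congr (Ideal.quotientEquiv I (I.map c) c rfl).symm.toEquiv

theorem absNorm_eq_of_mul_map_eq_span [Module.Finite ℤ R] (hR : Module.finrank ℤ R = 2)
    {P : Ideal R} {p : ℕ} (h : P * P.map c = Ideal.span {(p : R)}) : Ideal.absNorm P = p := by
  have := congrArg Ideal.absNorm h
  rw [map_mul, absNorm_map_equiv, Ideal.absNorm_span_natCast, hR, ← sq] at this
  exact Nat.pow_left_injective two_ne_zero this

theorem absNorm_span_singleton_eq_of_mul_map_eq [Module.Finite ℤ R]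
    (hR : Module.finrank ℤ R = 2) {a : R} {n : ℕ} (h : a * c a = n) :
    Ideal.absNorm (Ideal.span {a}) = n := by
  refine absNorm_eq_of_mul_map_eq_span (c := c) hR ?_
  rw [Ideal.map_span, Set.image_singleton, Ideal.span_singleton_mul_span_singleton]
  exact congrArg (fun x ↦ Ideal.span {x}) h

theorem exists_prime_eq_span_of_not_prime_absNorm [Module.Finite ℤ R] [CharZero R]
    (hR : Module.finrank ℤ R = 2)
    {P : Ideal R} (hP : P.IsPrime) (hP0 : P ≠ ⊥) (h : ¬ (Ideal.absNorm P).Prime) :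
    ∃ p : ℕ, p.Prime ∧ P = Ideal.span {(p : R)} := by
  have := hP.isMaximal hP0
  obtain ⟨p, k, hk, hpP, hp, hPk⟩ := P.exists_prime_and_absNorm_eq_pow
  refine ⟨p, hp, ?_⟩
  obtain ⟨J, hJ⟩ := Ideal.dvd_iff_le.mpr ((Ideal.span_singleton_le_iff_mem P).mpr hpP)
  have hJn := congrArg Ideal.absNorm hJ
  rw [map_mul, Ideal.absNorm_span_natCast, hR, hPk] at hJn
  have hk2 : 2 ≤ k := by
    by_contra! hlt
    obtain rfl : k = 1 := by omega
    exact h (by rwa [hPk, pow_one])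
  have hJ1 : Ideal.absNorm J = 1 := by
    obtain ⟨i, rfl⟩ := Nat.exists_eq_add_of_le hk2
    rw [pow_add, mul_assoc] at hJn
    exact Nat.eq_one_of_mul_eq_one_left
      (Nat.eq_of_mul_eq_mul_left (pow_pos hp.pos 2) (by rw [mul_one]; exact hJn)).symm
  rw [hJ, Ideal.absNorm_eq_one_iff.mp hJ1, Ideal.mul_top]

end ConjugationNorm

section QuadraticField

open NumberField

variable {F : Type*} [Field F] [NumberField F]

theorem exists_eq_add_mul_of_finrank_eq_two (hF : Module.finrank ℚ F = 2) {c : F ≃ₐ[ℚ] F}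
    {δ : F} (hδ0 : δ ≠ 0) (hcδ : c δ = -δ) (a : F) : ∃ x y : ℚ, a = x + y * δ := by
  have hli : LinearIndependent ℚ ![1, δ] := by
    rw [LinearIndependent.pair_iff]
    intro s t h
    simp only [Algebra.smul_def, mul_one, eq_ratCast] at h
    have h' := congrArg c h
    simp only [map_add, map_mul, map_ratCast, hcδ, map_zero] at h'
    have hs : (s : F) = 0 := by linear_combination (h + h') / 2
    have ht : (t : F) * δ = 0 := by linear_combination (h - h') / 2
    exact ⟨by exact_mod_cast hs, by simpa [hδ0] using ht⟩
  have htop := hli.span_eq_top_of_card_eq_finrank (by simp [hF])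
  have ha : a ∈ Submodule.span ℚ (Set.range ![1, δ]) := htop ▸ Submodule.mem_top
  rw [Matrix.range_cons, Matrix.range_cons, Matrix.range_empty, Set.union_empty,
    Set.singleton_union, Submodule.mem_span_pair] at ha
  obtain ⟨x, y, rfl⟩ := ha
  exact ⟨x, y, by simp [Algebra.smul_def]⟩

theorem exists_int_eq_of_ratCast_eq {a : 𝓞 F} {x : ℚ} (h : (a : F) = x) : ∃ k : ℤ, a = k := by
  have hx : IsIntegral ℤ x := by
    rw [← isIntegral_algebraMap_iff (algebraMap ℚ F).injective, eq_ratCast, ← h]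
    exact RingOfIntegers.isIntegral_coe a
  obtain ⟨k, rfl⟩ := IsIntegrallyClosed.isIntegral_iff.mp hx
  exact ⟨k, RingOfIntegers.ext (by rw [h]; simp)⟩

theorem exists_add_mapRingEquiv_eq_intCast (hF : Module.finrank ℚ F = 2) {c : F ≃ₐ[ℚ] F}
    {δ : F} (hδ0 : δ ≠ 0) (hcδ : c δ = -δ) (a : 𝓞 F) :
    ∃ k : ℤ, a + RingOfIntegers.mapRingEquiv c.toRingEquiv a = k := by
  obtain ⟨x, y, h⟩ := exists_eq_add_mul_of_finrank_eq_two hF hδ0 hcδ (a : F)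
  refine exists_int_eq_of_ratCast_eq (x := 2 * x) ?_
  change (a : F) + c a = _
  simp [h, hcδ]
  ring

theorem exists_mul_mapRingEquiv_eq_natCast (hF : Module.finrank ℚ F = 2) {c : F ≃ₐ[ℚ] F}
    {δ : F} {m : ℕ} (hm : m ≠ 0) (hδ : δ ^ 2 = -m) (hcδ : c δ = -δ) (a : 𝓞 F) :
    ∃ k : ℕ, a * RingOfIntegers.mapRingEquiv c.toRingEquiv a = k := by
  have hδ0 : δ ≠ 0 := by
    rintro rfl
    simp [hm] at hδ
  obtain ⟨x, y, h⟩ := exists_eq_add_mul_of_finrank_eq_two hF hδ0 hcδ (a : F)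
  have hx : ((a * RingOfIntegers.mapRingEquiv c.toRingEquiv a : 𝓞 F) : F) =
      ((x ^ 2 + m * y ^ 2 : ℚ) : F) := by
    change (a : F) * c a = _
    simp [h, hcδ]
    linear_combination -y ^ 2 * hδ
  obtain ⟨k, hk⟩ := exists_int_eq_of_ratCast_eq hx
  have hk0 : 0 ≤ k := by
    rw [hk] at hx
    have : (k : ℚ) = x ^ 2 + m * y ^ 2 := Rat.cast_injective (α := F) (by rw [← hx]; simp)
    have : (0 : ℚ) ≤ k := by rw [this]; positivity
    exact_mod_cast this
  lift k to ℕ using hk0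
  exact ⟨k, by simpa using hk⟩

end QuadraticField

section PrincipalPrimes

open NumberField IsDedekindDomain
open scoped nonZeroDivisors

variable {R : Type*} [CommRing R] [IsDedekindDomain R]

/-- The element of the monoid of nonzero ideals attached to a nonzero prime. -/
def IsDedekindDomain.HeightOneSpectrum.toNonZeroDivisors (v : HeightOneSpectrum R) :
    (Ideal R)⁰ :=
  ⟨v.asIdeal, mem_nonZeroDivisors_of_ne_zero v.ne_bot⟩

theorem Ideal.nonZeroDivisors_coe_dvd_coe {I J : (Ideal R)⁰} : (I : Ideal R) ∣ J ↔ I ∣ J := by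
  refine ⟨fun ⟨L, hL⟩ ↦ ?_, fun ⟨L, hL⟩ ↦ ⟨L, by rw [hL]; rfl⟩⟩
  have hL0 : L ≠ 0 := by
    rintro rfl
    exact nonZeroDivisors.coe_ne_zero J (by simpa using hL)
  exact ⟨⟨L, mem_nonZeroDivisors_of_ne_zero hL0⟩, Subtype.ext hL⟩

/-- If the sum of the inverse norms of the primes of square ideal class diverges, then so does the
sum over the principal primes. -/
theorem not_summable_indicator_mk0_eq_one {F : Type*} [Field F] [NumberField F]
    [IsTotallyComplex F] (hF : Module.finrank ℚ F = 2)
    (hsq : ¬ Summable ({v : HeightOneSpectrum (𝓞 F) |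
      IsSquare (ClassGroup.mk0 v.toNonZeroDivisors)}.indicator
        fun v ↦ (Ideal.absNorm v.asIdeal : ℝ)⁻¹)) :
    ¬ Summable ({v : HeightOneSpectrum (𝓞 F) |
      ClassGroup.mk0 v.toNonZeroDivisors = 1}.indicator
        fun v ↦ (Ideal.absNorm v.asIdeal : ℝ)⁻¹) := by
  classical
  obtain ⟨κ, C, hκ, h⟩ := exists_forall_abs_card_absNorm_le_mk_eq_sub_le (F := F) hF
  have : IsCancelMul (Ideal (𝓞 F))⁰ := by
    have hl : IsLeftCancelMul (Ideal (𝓞 F))⁰ :=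
      ⟨fun a b c h ↦ Subtype.ext (mul_left_cancel₀ (nonZeroDivisors.coe_ne_zero a)
        (congrArg Subtype.val h))⟩
    exact CommMagma.IsLeftCancelMul.toIsCancelMul _
  refine not_summable_indicator_map_eq_one (M := (Ideal (𝓞 F))⁰) (G := ClassGroup (𝓞 F))
    (N := (Ideal.absNorm (S := 𝓞 F)).toMonoidHom.comp (Ideal (𝓞 F))⁰.subtype)
    (cl := ClassGroup.mk0) (T := fun n ↦ (Ideal.finite_setOfPred_absNorm_le₀ (S := 𝓞 F) n).toFinset)
    (κ := κ) (C := C) HeightOneSpectrum.toNonZeroDivisors ?_ ?_ ?_ ?_ ?_ ?_ hκ ?_ hsq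
  · intro v w b hvw hdvd
    rw [← Ideal.nonZeroDivisors_coe_dvd_coe] at hdvd ⊢
    refine (v.prime.dvd_or_dvd hdvd).resolve_left fun hd ↦ hvw ?_
    refine HeightOneSpectrum.ext ?_
    exact ((w.isMaximal.eq_of_le v.isPrime.ne_top (Ideal.dvd_iff_le.mp hd))).symm
  · intro a ha
    have ha' : (a : Ideal (𝓞 F)) ≠ ⊤ := fun h ↦ ha (Subtype.ext (by simpa using h))
    obtain ⟨P, hP, haP⟩ := Ideal.exists_le_maximal _ ha'
    have hP0 : P ≠ ⊥ := fun h ↦ nonZeroDivisors.coe_ne_zero a (le_bot_iff.mp (h ▸ haP))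
    exact ⟨⟨P, hP.isPrime, hP0⟩, Ideal.nonZeroDivisors_coe_dvd_coe.mp (Ideal.dvd_iff_le.mpr haP)⟩
  · intro v hv
    exact v.prime.not_isUnit (isUnit_of_dvd_one (Ideal.nonZeroDivisors_coe_dvd_coe.mpr hv))
  · intro v
    have h0 := Ideal.absNorm_ne_zero_of_nonZeroDivisors v.toNonZeroDivisors
    have h1 : Ideal.absNorm v.asIdeal ≠ 1 := fun h ↦
      v.isPrime.ne_top (Ideal.absNorm_eq_one_iff.mp h)
    exact (Nat.two_le_iff _).mpr ⟨h0, h1⟩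
  · intro n a
    simp
  · exact Ideal.absNorm_ne_zero_of_nonZeroDivisors
  · intro g n
    convert h g n using 4
    exact (Nat.subtype_card _ (by simp)).symm

theorem not_summable_indicator_isSquare_mk0 [CharZero R] [Module.Free ℤ R] [Module.Finite ℤ R]
    (hR : Module.finrank ℤ R = 2) {c : R ≃+* R} (htr : ∀ a, ∃ k : ℤ, a + c a = k)
    (hnm : ∀ a, ∃ k : ℤ, a * c a = k) {δ : R} {m : ℕ} (hδ : δ ^ 2 = -m) (hcδ : c δ = -δ)
    (hm : 2 ≤ m) :
    ¬ Summable ({v : HeightOneSpectrum R |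
      IsSquare (ClassGroup.mk0 v.toNonZeroDivisors)}.indicator
        fun v ↦ (Ideal.absNorm v.asIdeal : ℝ)⁻¹) := by
  intro hsum
  have : NeZero (4 * m) := ⟨by omega⟩
  let S := {p : ℕ | p.Prime ∧ (p : ZMod (4 * m)) = 1}
  have key (p : S) : ∃ v : HeightOneSpectrum R, Ideal.absNorm v.asIdeal = p ∧
      IsSquare (ClassGroup.mk0 v.toNonZeroDivisors) := by
    obtain ⟨p, hp, hpm⟩ := p
    have hpm' : p % (4 * m) = 1 := by
      rw [← Nat.cast_one, ZMod.natCast_eq_natCast_iff', Nat.mod_eq_of_lt (by omega : 1 < 4 * m)]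
        at hpm
      exact hpm
    obtain ⟨P, hP, hPsq⟩ := exists_mul_map_eq_span_and_isSquare_mk0 htr hnm hδ hcδ hm hp hpm'
    have hPp := absNorm_eq_of_mul_map_eq_span hR hP
    exact ⟨⟨P, Ideal.isPrime_of_irreducible_absNorm (hPp ▸ hp), nonZeroDivisors.coe_ne_zero P⟩,
      hPp, hPsq⟩
  choose f hf hfsq using key
  have hinj : Function.Injective f := fun p q h ↦ Subtype.ext (by rw [← hf, ← hf, h])
  refine not_summable_indicator_prime_residueClass (q := 4 * m) isUnit_one ?_
  rw [← summable_subtype_iff_indicator]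
  refine (hsum.comp_injective hinj).congr fun p ↦ ?_
  rw [Function.comp_apply, Set.indicator_of_mem (by exact hfsq p), hf]
  rfl

theorem summable_indicator_not_prime_absNorm [CharZero R] [Module.Free ℤ R] [Module.Finite ℤ R]
    (hR : Module.finrank ℤ R = 2) :
    Summable ({v : HeightOneSpectrum R | ¬ (Ideal.absNorm v.asIdeal).Prime}.indicator
        fun v ↦ (Ideal.absNorm v.asIdeal : ℝ)⁻¹) := by
  rw [← summable_subtype_iff_indicator]
  have key (v : {v : HeightOneSpectrum R | ¬ (Ideal.absNorm v.asIdeal).Prime}) :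
      ∃ p : ℕ, p.Prime ∧ v.1.asIdeal = Ideal.span {(p : R)} :=
    exists_prime_eq_span_of_not_prime_absNorm hR v.1.isPrime v.1.ne_bot v.2
  choose f hf hfv using key
  have hinj : Function.Injective f := fun v w h ↦
    Subtype.ext (HeightOneSpectrum.ext (by rw [hfv, hfv, h]))
  refine ((Real.summable_nat_pow_inv.mpr one_lt_two).comp_injective hinj).congr fun v ↦ ?_
  rw [Function.comp_apply, Function.comp_apply, hfv, Ideal.absNorm_span_natCast, hR, Nat.cast_pow]

/-- An imaginary quadratic field other than `ℚ(i)` has an element of prime norm which is neither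
rational nor purely imaginary. -/
theorem exists_mul_map_eq_prime_of_sq_eq_neg {F : Type*} [Field F] [NumberField F]
    [IsTotallyComplex F] (hF : Module.finrank ℚ F = 2) {c : F ≃ₐ[ℚ] F} {δ : F} {m : ℕ}
    (hm : 2 ≤ m) (hδ : δ ^ 2 = -m) (hcδ : c δ = -δ) :
    ∃ p : ℕ, p.Prime ∧ ∃ a : 𝓞 F, (a : F) * c a = p ∧ c a ≠ a ∧ c a ≠ -a := by
  by_contra! hno
  have hR : Module.finrank ℤ (𝓞 F) = 2 := by rw [RingOfIntegers.rank, hF]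
  have hδ0 : δ ≠ 0 := by
    rintro rfl
    simp [show m ≠ 0 by omega] at hδ
  have htr := exists_add_mapRingEquiv_eq_intCast hF hδ0 hcδ
  have hnm := exists_mul_mapRingEquiv_eq_natCast hF (by omega) hδ hcδ
  set c' : 𝓞 F ≃+* 𝓞 F := RingOfIntegers.mapRingEquiv c.toRingEquiv
  have hδint : IsIntegral ℤ δ :=
    IsIntegral.of_pow two_pos (by rw [hδ]; exact (isIntegral_natCast m).neg)
  obtain ⟨ε, rfl⟩ : ∃ ε : 𝓞 F, δ = ε := ⟨⟨δ, hδint⟩, rfl⟩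
  have hε : ε ^ 2 = -m := RingOfIntegers.ext (by simpa using hδ)
  have hcε : c' ε = -ε := RingOfIntegers.ext hcδ
  have hnm_int (a : 𝓞 F) : ∃ k : ℤ, a * c' a = k := by
    obtain ⟨k, hk⟩ := hnm a
    exact ⟨k, by rw [hk, Int.cast_natCast]⟩
  refine not_summable_indicator_mk0_eq_one hF
    (not_summable_indicator_isSquare_mk0 hR htr hnm_int hε hcε hm) ?_
  have hfin : {v : HeightOneSpectrum (𝓞 F) | Ideal.absNorm v.asIdeal ≤ m}.Finite :=
    Set.Finite.of_finite_image
      ((Ideal.finite_setOfPred_absNorm_le m).subset (by rintro _ ⟨v, hv, rfl⟩; exact hv))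
      (fun v _ w _ h ↦ HeightOneSpectrum.ext h)
  have hbound := (summable_indicator_not_prime_absNorm hR).add
    (summable_of_hasFiniteSupport (hfin.subset Set.support_indicator_subset) :
      Summable ({v : HeightOneSpectrum (𝓞 F) | Ideal.absNorm v.asIdeal ≤ m}.indicator
        fun v ↦ (Ideal.absNorm v.asIdeal : ℝ)⁻¹))
  refine hbound.of_nonneg_of_le (fun v ↦ Set.indicator_nonneg (fun _ _ ↦ by positivity) v)
    fun v ↦ ?_
  have hnn (A : Set (HeightOneSpectrum (𝓞 F))) :
      0 ≤ A.indicator (fun v ↦ (Ideal.absNorm v.asIdeal : ℝ)⁻¹) v :=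
    Set.indicator_nonneg (fun _ _ ↦ by positivity) v
  by_cases hv : ClassGroup.mk0 v.toNonZeroDivisors = 1
  swap
  · rw [Set.indicator_of_notMem (by exact hv)]
    exact add_nonneg (hnn _) (hnn _)
  refine (Set.indicator_le_self' (fun _ _ ↦ by positivity) v).trans ?_
  by_cases hvp : (Ideal.absNorm v.asIdeal).Prime
  swap
  · rw [Set.indicator_of_mem (by exact hvp)]
    exact le_add_of_nonneg_right (hnn _)
  have hvm : Ideal.absNorm v.asIdeal ≤ m := by
    obtain ⟨a, ha⟩ := (ClassGroup.mk0_eq_one_iff v.toNonZeroDivisors.2).mp hv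
    obtain ⟨k, hk⟩ := hnm a
    have hka : Ideal.absNorm v.asIdeal = k := by
      rw [← absNorm_span_singleton_eq_of_mul_map_eq hR hk]
      exact congrArg Ideal.absNorm ha
    rw [hka] at hvp ⊢
    have hne := map_ne_self_of_mul_map_eq_prime htr hvp hk
    refine le_of_map_eq_neg_of_mul_map_eq_prime htr (by omega) hε hcε hvp hk
      (RingOfIntegers.ext ?_)
    exact hno k hvp a (congrArg (algebraMap (𝓞 F) F) hk |>.trans (by simp))
      (fun h ↦ hne (RingOfIntegers.ext h))
  rw [Set.indicator_of_mem (s := {v : HeightOneSpectrum (𝓞 F) | Ideal.absNorm v.asIdeal ≤ m}) hvm]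
  exact le_add_of_nonneg_left (hnn _)

end PrincipalPrimes

section Biquadratic

open NumberField IntermediateField

theorem isTotallyComplex_of_sq_eq_neg {F : Type*} [Field F] {δ : F} {m : ℕ} (hm : m ≠ 0)
    (hδ : δ ^ 2 = -m) : IsTotallyComplex F := by
  refine ⟨fun v ↦ InfinitePlace.not_isReal_iff_isComplex.mp fun hv ↦ ?_⟩
  have h := congrArg (InfinitePlace.embedding_of_isReal hv) hδ
  rw [map_pow, map_neg, map_natCast] at h
  have : (0 : ℝ) < m := by positivity
  nlinarith [sq_nonneg (InfinitePlace.embedding_of_isReal hv δ)]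

theorem mul_comm_of_forall_mul_self_eq_one {G : Type*} [Group G] (h : ∀ g : G, g * g = 1)
    (a b : G) : a * b = b * a := by
  have hinv (g : G) : g⁻¹ = g := (eq_inv_of_mul_eq_one_left (h g)).symm
  rw [← hinv (a * b), mul_inv_rev, hinv, hinv]

theorem eq_one_or_eq_of_card_eq_four {G : Type*} [Group G] (hG : Nat.card G = 4) {σ τ : G}
    (hσ : σ ≠ 1) (hτ : τ ≠ 1) (hστ : σ ≠ τ) (hV4 : ∀ g : G, g * g = 1) (g : G) :
    g = 1 ∨ g = σ ∨ g = τ ∨ g = σ * τ := by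
  classical
  have : Finite G := Nat.finite_of_card_ne_zero (by omega)
  have := Fintype.ofFinite G
  have h1 : σ * τ ≠ 1 := fun h ↦ hστ (mul_right_cancel (h.trans (hV4 τ).symm))
  have hcard : ({1, σ, τ, σ * τ} : Finset G).card = 4 := by
    rw [Finset.card_insert_of_notMem, Finset.card_insert_of_notMem,
      Finset.card_insert_of_notMem, Finset.card_singleton]
    · simpa using hσ
    · simpa [hστ] using hτ
    · simp [hσ.symm, hτ.symm, h1.symm]
  have huniv := Finset.eq_univ_of_card _ (hcard.trans (hG.symm.trans Nat.card_eq_fintype_card))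
  simpa using huniv.ge (Finset.mem_univ g)

variable {K : Type*} [Field K] [NumberField K] [IsGalois ℚ K]

/-- The fixed field of `σ` is generated by the square root of a negative integer. -/
theorem exists_sq_eq_neg_natCast (hdeg : Module.finrank ℚ K = 4)
    (hV4 : ∀ σ : K ≃ₐ[ℚ] K, σ * σ = 1) {σ τ : K ≃ₐ[ℚ] K}
    (hτ : ∀ (ι : K →+* ℂ) (x : K), ι (τ x) = starRingEnd ℂ (ι x))
    (hσ1 : σ ≠ 1) (hτ1 : τ ≠ 1) (hστ : σ ≠ τ) :
    ∃ (δ : K) (m : ℕ), 2 ≤ m ∧ δ ^ 2 = -m ∧ σ δ = δ ∧ τ δ = -δ := by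
  have hcard : Nat.card (K ≃ₐ[ℚ] K) = 4 := by rw [IsGalois.card_aut_eq_finrank, hdeg]
  have hττ (x : K) : τ (τ x) = x := DFunLike.congr_fun (hV4 τ) x
  have hcomm (x : K) : σ (τ x) = τ (σ x) :=
    DFunLike.congr_fun (mul_comm_of_forall_mul_self_eq_one hV4 σ τ) x
  obtain ⟨y, hy, hτy⟩ : ∃ y, σ y = y ∧ τ y ≠ y := by
    by_contra! hno
    have hmem : τ ∈ fixingSubgroup (fixedField (Subgroup.zpowers σ)) := by
      rw [IntermediateField.mem_fixingSubgroup_iff]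
      intro x hx
      exact hno x ((mem_fixedField_iff _ x).mp hx σ (Subgroup.mem_zpowers σ))
    rw [fixingSubgroup_fixedField] at hmem
    obtain ⟨k, hk⟩ := hmem
    rcases Int.even_or_odd' k with ⟨j, rfl | rfl⟩
    · exact hτ1 (by rw [← hk]; simp [zpow_mul, pow_two, zpow_ofNat, hV4])
    · exact hστ (by rw [← hk]; simp [zpow_add, zpow_mul, pow_two, zpow_ofNat, hV4])
  set δ := y - τ y with hδ
  have hδ0 : δ ≠ 0 := sub_ne_zero.mpr hτy.symm
  have hσδ : σ δ = δ := by rw [hδ, map_sub, hcomm, hy]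
  have hτδ : τ δ = -δ := by rw [hδ, map_sub, hττ, neg_sub]
  obtain ⟨q, hq⟩ : ∃ q : ℚ, δ ^ 2 = q := by
    have hmem : δ ^ 2 ∈ (⊥ : IntermediateField ℚ K) := by
      rw [IsGalois.mem_bot_iff_fixed]
      intro g
      rcases eq_one_or_eq_of_card_eq_four hcard hσ1 hτ1 hστ hV4 g with rfl | rfl | rfl | rfl <;>
        simp [hσδ, hτδ]
    obtain ⟨q, hq⟩ := mem_bot.mp hmem
    exact ⟨q, by simpa using hq.symm⟩
  have hq0 : q < 0 := by
    obtain ⟨ι⟩ : Nonempty (K →+* ℂ) := inferInstance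
    have h1 := hτ ι δ
    have h2 : ((-q : ℚ) : ℂ) = (Complex.normSq (ι δ) : ℂ) := by
      rw [← Complex.mul_conj, ← h1, hτδ, ← map_mul, mul_neg, ← sq, hq]
      simp
    have h3 : ((-q : ℚ) : ℝ) = Complex.normSq (ι δ) := by exact_mod_cast h2
    have h4 : 0 < Complex.normSq (ι δ) := Complex.normSq_pos.mpr (by simpa using hδ0)
    rw [← h3] at h4
    have : 0 < -q := by exact_mod_cast h4
    linarith
  have hnum : 0 < -q.num := by simpa using hq0
  obtain ⟨n, hn⟩ := Int.eq_ofNat_of_zero_le hnum.le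
  have hn0 : 0 < n := by omega
  refine ⟨2 * q.den * δ, 4 * (q.den * n), ?_, ?_, ?_, ?_⟩
  · have := Nat.mul_pos q.den_pos hn0
    omega
  · have hqd : (q : K) * q.den = -n := by
      have h1 : q * q.den = -n := by
        rw [Rat.mul_den_eq_num]
        have : q.num = -n := by omega
        rw [this]; simp
      exact_mod_cast congrArg (Rat.cast (K := K)) h1
    push_cast
    rw [mul_pow, hq]
    linear_combination 4 * (q.den : K) * hqd
  · rw [map_mul, hσδ]; simp [map_ofNat]
  · rw [map_mul, hτδ]; simp [map_ofNat]

theorem exists_mul_eq_prime_of_fixed (hdeg : Module.finrank ℚ K = 4)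
    (hV4 : ∀ σ : K ≃ₐ[ℚ] K, σ * σ = 1) {σ τ : K ≃ₐ[ℚ] K}
    (hτ : ∀ (ι : K →+* ℂ) (x : K), ι (τ x) = starRingEnd ℂ (ι x))
    (hσ1 : σ ≠ 1) (hτ1 : τ ≠ 1) (hστ : σ ≠ τ) :
    ∃ p : ℕ, p.Prime ∧ ∃ a : 𝓞 K, (a : K) * τ a = p ∧ σ a = a ∧ τ a ≠ a ∧ τ a ≠ -a := by
  obtain ⟨δ, m, hm, hδ, hσδ, hτδ⟩ := exists_sq_eq_neg_natCast hdeg hV4 hτ hσ1 hτ1 hστ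
  let F : IntermediateField ℚ K := fixedField (Subgroup.zpowers σ)
  have hmemF (x : K) : x ∈ F ↔ σ x = x := by
    refine ⟨fun hx ↦ (mem_fixedField_iff _ x).mp hx σ (Subgroup.mem_zpowers σ), fun hx ↦ ?_⟩
    rw [mem_fixedField_iff]
    intro f hf
    have hle : Subgroup.zpowers σ ≤ MulAction.stabilizer (K ≃ₐ[ℚ] K) x :=
      Subgroup.zpowers_le.mpr hx
    exact hle hf
  have hF2 : Module.finrank ℚ F = 2 := by
    have h1 : Module.finrank F K = 2 := by
      rw [finrank_fixedField_eq_card, Nat.card_zpowers]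
      exact orderOf_eq_prime (by rw [sq, hV4]) hσ1
    have h2 := Module.finrank_mul_finrank ℚ F K
    rw [h1, hdeg] at h2
    omega
  have : Algebra.IsQuadraticExtension ℚ F := ⟨hF2⟩
  let d : F := ⟨δ, (hmemF δ).mpr hσδ⟩
  have hd : d ^ 2 = -m := Subtype.ext (by simpa using hδ)
  have : IsTotallyComplex F := isTotallyComplex_of_sq_eq_neg (by omega) hd
  have hc (x : F) : ((τ.restrictNormal F x : F) : K) = τ x := τ.restrictNormal_commutes F x
  obtain ⟨p, hp, a, ha, ha1, ha2⟩ := exists_mul_map_eq_prime_of_sq_eq_neg hF2 hm hd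
    (c := τ.restrictNormal F) (Subtype.ext (by rw [hc]; exact hτδ))
  refine ⟨p, hp, algebraMap (𝓞 F) (𝓞 K) a, ?_, ?_, ?_, ?_⟩
  · have := congrArg (algebraMap F K) ha
    rw [map_mul, map_natCast] at this
    rw [← this]
    exact congrArg _ (hc a).symm
  · exact (hmemF _).mp (a : F).2
  · exact fun h ↦ ha1 (Subtype.ext ((hc a).trans h))
  · exact fun h ↦ ha2 (Subtype.ext ((hc a).trans h))

theorem exists_mul_eq_prime_adjoin_eq_top (hdeg : Module.finrank ℚ K = 4)
    (hV4 : ∀ σ : K ≃ₐ[ℚ] K, σ * σ = 1) (τ : K ≃ₐ[ℚ] K)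
    (hτ : ∀ (ι : K →+* ℂ) (x : K), ι (τ x) = starRingEnd ℂ (ι x)) {ζ : K} {t : ℤ}
    (ht : t = 0 ∨ t = 1) (hζ : ζ ^ 2 + t * ζ + 1 = 0) :
    ∃ p : ℕ, p.Prime ∧ ∃ π : 𝓞 K,
      (π : K) * τ (π : K) = (p : K) ∧ IntermediateField.adjoin ℚ {(π : K)} = ⊤ := by
  have hcard : Nat.card (K ≃ₐ[ℚ] K) = 4 := by rw [IsGalois.card_aut_eq_finrank, hdeg]
  have hconj (g : K ≃ₐ[ℚ] K) : g ζ = ζ ∨ g ζ = -t - ζ := by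
    have h := congrArg g hζ
    simp only [map_add, map_mul, map_pow, map_intCast, map_one, map_zero] at h
    have : (g ζ - ζ) * (g ζ - (-t - ζ)) = 0 := by linear_combination h - hζ
    simpa only [mul_eq_zero, sub_eq_zero] using this
  have hτζ' : τ ζ ≠ ζ := by
    intro h
    obtain ⟨ι⟩ : Nonempty (K →+* ℂ) := inferInstance
    have h1 := hτ ι ζ
    rw [h] at h1
    obtain ⟨r, hr⟩ := Complex.conj_eq_iff_real.mp h1.symm
    have h2 := congrArg ι hζ
    simp only [map_add, map_mul, map_pow, map_intCast, map_one, map_zero, hr] at h2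
    have h3 : r ^ 2 + t * r + 1 = 0 := by exact_mod_cast h2
    rcases ht with rfl | rfl <;> push_cast at h3 <;> nlinarith [sq_nonneg (2 * r + 1)]
  have hτζ := (hconj τ).resolve_left hτζ'
  have hτ1 : τ ≠ 1 := by rintro rfl; exact hτζ' rfl
  obtain ⟨σ, hστ, hσζ⟩ : ∃ σ : K ≃ₐ[ℚ] K, σ ≠ τ ∧ σ ζ = -t - ζ := by
    obtain ⟨g, hg1, hgτ⟩ : ∃ g : K ≃ₐ[ℚ] K, g ≠ 1 ∧ g ≠ τ := by
      classical
      by_contra! h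
      have := Fintype.ofFinite (K ≃ₐ[ℚ] K)
      have h2 : (Finset.univ : Finset (K ≃ₐ[ℚ] K)) ⊆ {1, τ} := fun g _ ↦ by
        simpa [or_iff_not_imp_left] using h g
      have := (Finset.card_le_card h2).trans Finset.card_le_two
      rw [Finset.card_univ, ← Nat.card_eq_fintype_card] at this
      omega
    rcases hconj g with hg | hg
    · refine ⟨g * τ, fun h ↦ hg1 (mul_eq_right.mp h), ?_⟩
      rw [AlgEquiv.mul_apply, hτζ, map_sub, map_neg, map_intCast, hg]
    · exact ⟨g, hgτ, hg⟩
  have hσζ' : σ ζ ≠ ζ := by rwa [hσζ, ← hτζ]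
  have hσ1 : σ ≠ 1 := by rintro rfl; exact hσζ' rfl
  obtain ⟨p, hp, a, ha, hσa, ha1, ha2⟩ :=
    exists_mul_eq_prime_of_fixed hdeg hV4 hτ hσ1 hτ1 hστ
  have ha0 : (a : K) ≠ 0 := by
    intro h
    rw [h, zero_mul] at ha
    exact hp.ne_zero (by exact_mod_cast ha.symm)
  have hζ0 : ζ ≠ 0 := by
    rintro rfl
    simp at hζ
  have hcomm (x : K) : σ (τ x) = τ (σ x) :=
    DFunLike.congr_fun (mul_comm_of_forall_mul_self_eq_one hV4 σ τ) x
  have hζint : IsIntegral ℤ ζ := by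
    refine ⟨Polynomial.X ^ 2 + (Polynomial.C t * Polynomial.X + Polynomial.C 1),
      Polynomial.monic_X_pow_add (by compute_degree!), ?_⟩
    simp only [Polynomial.eval₂_add, Polynomial.eval₂_mul, Polynomial.eval₂_pow,
      Polynomial.eval₂_X, Polynomial.eval₂_C]
    simp only [eq_intCast, Int.cast_one]
    linear_combination hζ
  refine ⟨p, hp, ⟨ζ, hζint⟩ * a, ?_, ?_⟩
  · change ζ * (a : K) * τ (ζ * (a : K)) = p
    rw [map_mul, hτζ]
    linear_combination ha - (a : K) * τ a * hζ
  · change adjoin ℚ {ζ * (a : K)} = ⊤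
    rw [← IsGalois.fixedField_fixingSubgroup (adjoin ℚ {ζ * (a : K)}), ← fixedField_bot]
    congr 1
    rw [eq_bot_iff]
    intro g hg
    rw [IntermediateField.mem_fixingSubgroup_iff] at hg
    have hga := hg _ (mem_adjoin_simple_self ℚ (ζ * (a : K)))
    rw [map_mul] at hga
    rcases eq_one_or_eq_of_card_eq_four hcard hσ1 hτ1 hστ hV4 g with rfl | rfl | hgτ | rfl
    · exact one_mem _
    · rw [hσa] at hga
      exact absurd (mul_right_cancel₀ ha0 hga) hσζ'
    · rw [hgτ, hτζ] at hga
      have h1 : τ a = ζ ^ 2 * a := by linear_combination ζ * hga + τ a * hζ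
      have h2 := congrArg σ h1
      rw [hcomm, map_mul, map_pow, hσa, h1] at h2
      have h3 := mul_right_cancel₀ ha0 h2
      have h4 := (sq_eq_sq_iff_eq_or_eq_neg.mp h3).resolve_left hσζ'.symm
      have ht0 : (t : K) = 0 := by linear_combination hσζ - h4
      refine absurd ?_ ha2
      linear_combination h1 + a * hζ - a * ζ * ht0
    · rw [AlgEquiv.mul_apply, AlgEquiv.mul_apply, hcomm (a : K), hσa, hτζ, map_sub, map_neg,
        map_intCast, hσζ, sub_sub_cancel] at hga
      exact absurd (mul_left_cancel₀ hζ0 hga) ha1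

end Biquadratic

open NumberField

/-- a totally complex biquadratic field containing `ℚ(i)` or `ℚ(ζ₃)` is
generated by an ordinary `p`-Weil number for some prime `p`. -/
theorem exists_weil_generator_of_biquadratic (K : Type*) [Field K] [NumberField K]
    [IsGalois ℚ K] (hdeg : Module.finrank ℚ K = 4)
    (hV4 : ∀ σ : K ≃ₐ[ℚ] K, σ * σ = 1)
    (hcomplex : IsEmpty (K →+* ℝ))
    (τ : K ≃ₐ[ℚ] K) (hτ : ∀ (ι : K →+* ℂ) (x : K), ι (τ x) = starRingEnd ℂ (ι x))
    (hzeta : (∃ ζ : K, ζ ^ 2 = -1) ∨ (∃ ζ : K, ζ ^ 2 + ζ + 1 = 0)) :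
    ∃ p : ℕ, p.Prime ∧ ∃ π : 𝓞 K,
      (π : K) * τ (π : K) = (p : K) ∧ IntermediateField.adjoin ℚ {(π : K)} = ⊤ := by
  rcases hzeta with ⟨ζ, hζ⟩ | ⟨ζ, hζ⟩
  · exact exists_mul_eq_prime_adjoin_eq_top hdeg hV4 τ hτ (t := 0) (ζ := ζ) (by simp) (by simp [hζ])
  · exact exists_mul_eq_prime_adjoin_eq_top hdeg hV4 τ hτ (t := 1) (ζ := ζ) (by simp)
      (by simpa using hζ)
end

section
/- Let G ≤ W be a subgroup containing c and acting transitively on X, and let w : X → ℚ be a weight function. If the greatest common divisor of the cardinalities |{x ∈ X : w(x) = s}|, as s ranges over the (finitely many) distinct values of w, equals 1, then the weighted permutation representation ρ = (w, G) is geometrically simple. -/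
open scoped BigOperators

open PaperAux

namespace PaperAux

/-- `Phi w G x` is the element of the group algebra whose coefficient at `σ` is `w (σ⁻¹ x)`. -/
theorem Phi_eq_sum_single {g : ℕ} (w : X g → ℚ) (G : Subgroup (Equiv.Perm (X g))) [Fintype G]
    (x : X g) :
    Phi w G x = ∑ σ : G, MonoidAlgebra.single σ (w ((σ : Equiv.Perm (X g))⁻¹ x)) := by
  rw [Phi, finsum_eq_sum_of_fintype]
  simp [MonoidAlgebra.of_apply]

/-- Left multiplication by `τ` sends `Phi w G x` to `Phi w G (τ x)`. -/
theorem of_mul_Phi {g : ℕ} (w : X g → ℚ) (G : Subgroup (Equiv.Perm (X g))) (τ : G) (x : X g) :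
    MonoidAlgebra.of ℚ G τ * Phi w G x = Phi w G ((τ : Equiv.Perm (X g)) x) := by
  have := Fintype.ofFinite G
  rw [Phi_eq_sum_single, Phi_eq_sum_single, Finset.mul_sum]
  refine Fintype.sum_equiv (Equiv.mulLeft τ) _ _ fun σ => ?_
  simp [MonoidAlgebra.of_apply, MonoidAlgebra.single_mul_single]

/-- `Phi w G x = Phi w G y` exactly when `w` agrees along the orbits of `x` and `y`. -/
theorem Phi_eq_Phi_iff {g : ℕ} (w : X g → ℚ) (G : Subgroup (Equiv.Perm (X g))) (x y : X g) :
    Phi w G x = Phi w G y ↔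
      ∀ σ : G, w ((σ : Equiv.Perm (X g))⁻¹ x) = w ((σ : Equiv.Perm (X g))⁻¹ y) := by
  classical
  have := Fintype.ofFinite G
  rw [Phi_eq_sum_single, Phi_eq_sum_single]
  constructor
  · intro h σ
    simpa [Finsupp.single_apply] using
      congrArg (fun a : MonoidAlgebra ℚ G => a.coeff σ) h
  · intro h
    simp only [h]

/-- If `G` is transitive, all fibers of `Phi w G` have the same cardinality. -/
theorem card_fiber_Phi {g : ℕ} (w : X g → ℚ) (G : Subgroup (Equiv.Perm (X g)))
    (htrans : ∀ x y : X g, ∃ σ ∈ G, σ x = y) [DecidableEq (MonoidAlgebra ℚ G)] (x y : X g) :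
    (Finset.univ.filter fun z => Phi w G z = Phi w G x).card =
      (Finset.univ.filter fun z => Phi w G z = Phi w G y).card := by
  obtain ⟨σ, hσ, rfl⟩ := htrans x y
  refine Finset.card_equiv σ fun z => ?_
  have h := of_mul_Phi w G ⟨σ, hσ⟩
  simp only [Finset.mem_filter, Finset.mem_univ, true_and]
  rw [← h, ← h]
  exact ((Group.isUnit (⟨σ, hσ⟩ : G)).map (MonoidAlgebra.of ℚ G)).mul_right_inj.symm

/-- If `G` is transitive, the cardinality of a fiber of `Phi w G` divides that of every level set
of `w`. -/
theorem card_fiber_Phi_dvd {g : ℕ} (w : X g → ℚ) (G : Subgroup (Equiv.Perm (X g)))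
    (htrans : ∀ x y : X g, ∃ σ ∈ G, σ x = y) [DecidableEq (MonoidAlgebra ℚ G)] (x : X g) (s : ℚ) :
    (Finset.univ.filter fun z => Phi w G z = Phi w G x).card ∣
      (Finset.univ.filter fun z => w z = s).card := by
  rw [Finset.card_eq_sum_card_image (Phi w G) (Finset.univ.filter fun z => w z = s)]
  refine Finset.dvd_sum fun b hb => ?_
  obtain ⟨y, hy, rfl⟩ := Finset.mem_image.mp hb
  rw [card_fiber_Phi w G htrans x y, Finset.filter_filter]
  refine dvd_of_eq (congrArg Finset.card (Finset.filter_congr fun z _ => ?_))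
  refine ⟨fun h => ⟨?_, h⟩, And.right⟩
  have hz : w z = w y := by simpa using (Phi_eq_Phi_iff w G z y).mp h 1
  exact hz.trans (Finset.mem_filter.mp hy).2

end PaperAux

/-- if the gcd of the multiplicities of the distinct weights is `1`, then
`ρ = (w, G)` is geometrically simple. -/
theorem geomSimple_of_gcd_lengths_eq_one {g : ℕ} (hg : 0 < g) (w : X g → ℚ)
    (hw : IsWeightFn g w)
    (G : Subgroup (Equiv.Perm (X g))) (hGW : G ≤ Wgrp g) (hc : conjPerm g ∈ G)
    (htrans : ∀ x y : X g, ∃ σ ∈ G, σ x = y)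
    (hgcd : (Finset.univ.image w).gcd
        (fun s => (Finset.univ.filter fun x : X g => w x = s).card) = 1) :
    GeomSimple w G (Sum.inl ⟨0, hg⟩) := by
  classical
  intro σ
  rw [of_mul_Phi]
  refine ⟨fun h => ?_, fun h => by rw [h]⟩
  have hdvd := Finset.dvd_gcd fun s (_ : s ∈ Finset.univ.image w) =>
    card_fiber_Phi_dvd w G htrans (Sum.inl ⟨0, hg⟩) s
  rw [hgcd, Nat.dvd_one] at hdvd
  exact Finset.card_le_one.mp hdvd.le _ (by simpa using h) _ (by simp)
end
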